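/- arXiv:2212.04308 — 6 statements merged into one kernel-verified Lean document; each statement's English description precedes it below -/
import Mathlib

section
/- Let Q ⊆ ℝ^d be a set whose convex hull contains the closed Euclidean unit ball B^d. Then there exist at most 2d points of Q whose convex hull Q' satisfies (1/(6d²))·B^d ⊆ Q'. -/
open Pointwise

open Module in
/-- A compact spanning set contains a basis in which all its points have coordinates in `[-1, 1]`. -/
theorem exists_basis_abs_repr_le_one {V : Type*} [NormedAddCommGroup V] [NormedSpace ℝ V]
    [FiniteDimensional ℝ V] {A : Set V} (hA : IsCompact A) (hs : Submodule.span ℝ A = ⊤) :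
    ∃ b : Basis (Fin (finrank ℝ V)) ℝ V, (∀ i, b i ∈ A) ∧ ∀ x ∈ A, ∀ i, |b.repr x i| ≤ 1 := by
  classical
  obtain ⟨s, hsA, hspan, hli⟩ := exists_linearIndependent ℝ A
  let e₀ : Basis s ℝ V := Basis.mk hli (by simp [hspan, hs])
  have : Fintype s := FiniteDimensional.fintypeBasisIndex e₀
  let e : Basis (Fin (finrank ℝ V)) ℝ V :=
    e₀.reindex (Fintype.equivFinOfCardEq (finrank_eq_card_basis e₀).symm)
  have heA : ∀ i, e i ∈ A := fun i => by
    simp only [e, e₀, Basis.reindex_apply, Basis.mk_apply]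
    exact hsA (Subtype.coe_prop _)
  have hcont : Continuous fun v : Fin (finrank ℝ V) → V => |e.det v| := by
    simp only [Basis.det_apply]
    refine (Continuous.matrix_det (continuous_matrix fun i j => ?_)).abs
    exact (LinearMap.continuous_of_finiteDimensional (e.coord i)).comp (continuous_apply j)
  obtain ⟨v, hvA, hv⟩ := (isCompact_univ_pi fun _ : Fin (finrank ℝ V) => hA).exists_isMaxOn
    ⟨e, fun i _ => heA i⟩ hcont.continuousOn
  have hpos : 0 < |e.det v| := by
    have h := hv (a := ⇑e) fun i _ => heA i
    simp only [Set.mem_ofPred_eq, e.det_self, abs_one] at h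
    linarith
  obtain ⟨hvli, hvs⟩ := e.is_basis_iff_det.2 (abs_pos.1 hpos).isUnit
  refine ⟨Basis.mk hvli hvs.ge, fun i => ?_, fun x hx i => ?_⟩
  · simpa using hvA i trivial
  · have h := congrArg abs (congrFun (congrArg DFunLike.coe
      (e.det_smul_mk_coord_eq_det_update hvli hvs.ge i)) x)
    have hle := hv (a := Function.update v i x) fun j _ => by
      rcases eq_or_ne j i with rfl | hj
      · simpa using hx
      · simpa [hj] using hvA j trivial
    simp only [Set.mem_ofPred_eq] at hle
    simp only [LinearMap.smul_apply, smul_eq_mul, abs_mul, Basis.coord_apply] at h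
    refine le_of_mul_le_mul_left ?_ hpos
    rw [h, mul_one]
    simpa using hle

open Module in
/-- A conic version of Carathéodory's theorem that does not increase the total weight. -/
theorem exists_conic_combination_card_le_finrank {V : Type*} [AddCommGroup V] [Module ℝ V]
    [FiniteDimensional ℝ V] (T : Finset V) (w : V → ℝ) (hw : ∀ x ∈ T, 0 ≤ w x) :
    ∃ S ⊆ T, S.card ≤ finrank ℝ V ∧ ∃ w' : V → ℝ, (∀ x ∈ S, 0 ≤ w' x) ∧
      ∑ x ∈ S, w' x • x = ∑ x ∈ T, w x • x ∧ ∑ x ∈ S, w' x ≤ ∑ x ∈ T, w x := by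
  classical
  induction hn : T.card using Nat.strong_induction_on generalizing T w with
  | _ n ih =>
  by_cases hc : T.card ≤ finrank ℝ V
  · exact ⟨T, subset_rfl, hc, w, hw, rfl, le_rfl⟩
  obtain ⟨f, hf, hfs, hfp⟩ : ∃ f : V → ℝ, ∑ x ∈ T, f x • x = 0 ∧ 0 ≤ ∑ x ∈ T, f x ∧
      ∃ x ∈ T, 0 < f x := by
    obtain ⟨f, hf, x, hx, hfx⟩ := exists_nontrivial_relation_of_finrank_lt_card (not_le.1 hc)
    have key : ∀ g : V → ℝ, g x ≠ 0 → 0 ≤ ∑ x ∈ T, g x → ∃ x ∈ T, 0 < g x := by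
      intro g hgx hg
      by_contra! h
      exact (Finset.sum_neg' h ⟨x, hx, lt_of_le_of_ne (h x hx) hgx⟩).not_ge hg
    rcases le_total 0 (∑ x ∈ T, f x) with h | h
    · exact ⟨f, hf, h, key f hfx h⟩
    · have h' : 0 ≤ ∑ x ∈ T, (-f) x := by simpa using h
      exact ⟨-f, by simp [hf], h', key (-f) (by simpa using hfx) h'⟩
  obtain ⟨y, hy, hymin⟩ := (T.filter fun x => 0 < f x).exists_min_image (fun x => w x / f x)
    (by obtain ⟨x, hx, h⟩ := hfp; exact ⟨x, by simp [hx, h]⟩)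
  simp only [Finset.mem_filter] at hy hymin
  set τ := w y / f y with hτ
  have hτ0 : 0 ≤ τ := div_nonneg (hw y hy.1) hy.2.le
  have hy0 : w y - τ * f y = 0 := by rw [hτ, div_mul_cancel₀ _ hy.2.ne', sub_self]
  have hw' : ∀ x ∈ T, 0 ≤ w x - τ * f x := by
    intro x hx
    rcases lt_or_ge 0 (f x) with h | h
    · have := (le_div_iff₀ h).1 (hymin x ⟨hx, h⟩)
      linarith
    · nlinarith [hw x hx, mul_nonneg hτ0 (neg_nonneg.2 h)]
  obtain ⟨S, hST, hcard, w', h0, h1, h2⟩ := ih (T.erase y).card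
    (hn ▸ Finset.card_erase_lt_of_mem hy.1) (T.erase y) (fun x => w x - τ * f x)
    (fun x hx => hw' x (Finset.mem_of_mem_erase hx)) rfl
  refine ⟨S, hST.trans (Finset.erase_subset _ _), hcard, w', h0, h1.trans ?_, h2.trans ?_⟩
  · rw [Finset.sum_erase _ (by simp [hy0])]
    simp [sub_smul, mul_smul, ← Finset.smul_sum, hf]
  · rw [Finset.sum_erase (f := fun x => w x - τ * f x) _ hy0, Finset.sum_sub_distrib, ← Finset.mul_sum]
    linarith [mul_nonneg hτ0 hfs]

open Module in
/-- Minkowski's bound on the asymmetry of a convex body. -/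
theorem exists_mem_forall_sub_smul_sub_mem {E : Type*} [NormedAddCommGroup E] [NormedSpace ℝ E]
    [FiniteDimensional ℝ E] (hd : 1 ≤ finrank ℝ E) {K : Set E} (hK : IsCompact K)
    (hconv : Convex ℝ K) (h0 : (0 : E) ∈ K) (habs : ∀ y : E, ∃ ε : ℝ, 0 < ε ∧ ε • y ∈ K) :
    ∃ z ∈ K, ∀ x ∈ K, z - (1 / (finrank ℝ E : ℝ)) • (x - z) ∈ K := by
  have hd0 : (0 : ℝ) < finrank ℝ E := by exact_mod_cast hd
  set A : Set (ℝ × E) := (fun x => ((1 : ℝ), x)) '' K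
  have hA : IsCompact A := hK.image (by fun_prop)
  have hspan : Submodule.span ℝ A = ⊤ := by
    rw [eq_top_iff]
    rintro ⟨a, y⟩ -
    obtain ⟨ε, hε, hy⟩ := habs y
    have h1 : ((1 : ℝ), (0 : E)) ∈ Submodule.span ℝ A :=
      Submodule.subset_span ⟨0, h0, rfl⟩
    have h2 : ((1 : ℝ), ε • y) ∈ Submodule.span ℝ A :=
      Submodule.subset_span ⟨ε • y, hy, rfl⟩
    have h3 : (a, y) = a • ((1 : ℝ), (0 : E)) + ε⁻¹ • (((1 : ℝ), ε • y) - ((1 : ℝ), (0 : E))) := by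
      simp [smul_smul, hε.ne']
    rw [h3]
    exact Submodule.add_mem _ (Submodule.smul_mem _ _ h1)
      (Submodule.smul_mem _ _ (Submodule.sub_mem _ h2 h1))
  obtain ⟨b, hbA, hb⟩ := exists_basis_abs_repr_le_one hA hspan
  choose p hpK hp using hbA
  have hcard : (Fintype.card (Fin (finrank ℝ (ℝ × E))) : ℝ) = finrank ℝ E + 1 := by
    simp [add_comm]
  set n : ℝ := (finrank ℝ E : ℝ)
  have hz : ∑ i, (1 / (n + 1)) • p i ∈ K :=
    hconv.sum_mem (fun _ _ => by positivity)
      (by rw [Finset.sum_const, Finset.card_univ, nsmul_eq_mul, hcard]; field_simp)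
      (fun i _ => hpK i)
  refine ⟨_, hz, fun x hx => ?_⟩
  set c := b.repr ((1 : ℝ), x)
  have hsum : ∑ i, c i • ((1 : ℝ), p i) = ((1 : ℝ), x) := by
    simp only [hp]; exact b.sum_repr _
  have hc1 : ∑ i, c i = 1 := by
    have := congrArg Prod.fst hsum
    simpa [Prod.fst_sum] using this
  have hcx : ∑ i, c i • p i = x := by
    have := congrArg Prod.snd hsum
    simpa [Prod.snd_sum] using this
  have heq : ∑ i, (1 / (n + 1)) • p i - (1 / n) • (x - ∑ i, (1 / (n + 1)) • p i) =
      ∑ i, ((1 - c i) / n) • p i := by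
    rw [← hcx, ← Finset.sum_sub_distrib, Finset.smul_sum, ← Finset.sum_sub_distrib]
    refine Finset.sum_congr rfl fun i _ => ?_
    rw [← sub_smul, smul_smul, ← sub_smul]
    congr 1
    field_simp
    ring
  rw [heq]
  refine hconv.sum_mem (fun i _ => ?_) ?_ (fun i _ => hpK i)
  · have := (abs_le.1 (hb _ ⟨x, hx, rfl⟩ i)).2
    exact div_nonneg (sub_nonneg.2 this) hd0.le
  · rw [← Finset.sum_div, Finset.sum_sub_distrib, hc1, Finset.sum_const, Finset.card_univ,
      nsmul_eq_mul, hcard]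
    field_simp
    ring

/-- The polar of a set in a real inner product space. -/
def innerPolar {E : Type*} [NormedAddCommGroup E] [InnerProductSpace ℝ E] (S : Set E) : Set E :=
  {x | ∀ q ∈ S, inner ℝ q x ≤ 1}

section Polar

variable {E : Type*} [NormedAddCommGroup E] [InnerProductSpace ℝ E]

theorem mem_innerPolar {S : Set E} {x : E} : x ∈ innerPolar S ↔ ∀ q ∈ S, inner ℝ q x ≤ 1 :=
  Iff.rfl

theorem zero_mem_innerPolar (S : Set E) : (0 : E) ∈ innerPolar S := fun q _ => by simp

theorem isClosed_innerPolar (S : Set E) : IsClosed (innerPolar S) := by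
  have : innerPolar S = ⋂ q ∈ S, {x | inner ℝ q x ≤ 1} := by
    ext x; simp [mem_innerPolar]
  rw [this]
  exact isClosed_biInter fun q _ => isClosed_le (by fun_prop) continuous_const

theorem convex_innerPolar (S : Set E) : Convex ℝ (innerPolar S) := by
  intro x hx y hy a b ha hb hab q hq
  rw [inner_add_right, inner_smul_right, inner_smul_right]
  nlinarith [mul_le_mul_of_nonneg_left (hx q hq) ha, mul_le_mul_of_nonneg_left (hy q hq) hb]

theorem innerPolar_convexHull (S : Set E) : innerPolar (convexHull ℝ S) = innerPolar S := by
  refine Set.Subset.antisymm (fun x hx q hq => hx q (subset_convexHull ℝ S hq)) fun x hx q hq => ?_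
  have hconv : Convex ℝ {q : E | inner ℝ q x ≤ 1} := by
    intro p hp r hr a b ha hb hab
    simp only [Set.mem_ofPred_eq] at hp hr ⊢
    rw [inner_add_left, inner_smul_left, inner_smul_left]
    simp only [conj_trivial]
    nlinarith [mul_le_mul_of_nonneg_left hp ha, mul_le_mul_of_nonneg_left hr hb]
  exact convexHull_min (fun q hq => hx q hq) hconv hq

theorem exists_pos_smul_mem_innerPolar (F : Finset E) (y : E) :
    ∃ ε : ℝ, 0 < ε ∧ ε • y ∈ innerPolar (F : Set E) := by
  have hs : 0 ≤ ∑ q ∈ F, |(inner ℝ q y : ℝ)| := Finset.sum_nonneg fun _ _ => abs_nonneg _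
  refine ⟨(1 + ∑ q ∈ F, |(inner ℝ q y : ℝ)|)⁻¹, by positivity, fun q hq => ?_⟩
  rw [inner_smul_right, inv_mul_le_iff₀ (by positivity)]
  have := Finset.single_le_sum (f := fun q => |(inner ℝ q y : ℝ)|) (fun _ _ => abs_nonneg _) hq
  linarith [le_abs_self (inner ℝ q y : ℝ)]

/-- A vector all of whose nonnegative multiples lie in a bounded set vanishes. -/
theorem eq_zero_of_forall_smul_mem_closedBall {K : Set E} {R : ℝ}
    (hK : K ⊆ Metric.closedBall 0 R) {x : E} (hx : ∀ t : ℝ, 0 ≤ t → t • x ∈ K) : x = 0 := by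
  by_contra hne
  have hpos : 0 < ‖x‖ := norm_pos_iff.2 hne
  have h := hK (hx ((|R| + 1) / ‖x‖) (by positivity))
  rw [mem_closedBall_zero_iff, norm_smul, Real.norm_of_nonneg (by positivity),
    div_mul_cancel₀ _ hpos.ne'] at h
  linarith [le_abs_self R]

/-- The bipolar theorem for a finite set with bounded polar. -/
theorem mem_convexHull_of_forall_mem_innerPolar [CompleteSpace E] [Nontrivial E] {T : Finset E}
    {R : ℝ} (hR : innerPolar (T : Set E) ⊆ Metric.closedBall 0 R) {p : E}
    (hp : ∀ x ∈ innerPolar (T : Set E), inner ℝ p x ≤ 1) : p ∈ convexHull ℝ (T : Set E) := by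
  by_contra hmem
  obtain ⟨f, α, hf, hα⟩ := geometric_hahn_banach_closed_point (convex_convexHull ℝ (T : Set E))
    (T.finite_toSet.isClosed_convexHull ℝ) hmem
  set x := (InnerProductSpace.toDual ℝ E).symm f
  have hfx : ∀ q, f q = inner ℝ q x := fun q => by
    rw [real_inner_comm, InnerProductSpace.toDual_symm_apply]
  have hT : ∀ q ∈ T, inner ℝ q x < α := fun q hq => hfx q ▸ hf q (subset_convexHull ℝ _ hq)
  rw [hfx] at hα
  rcases lt_or_ge 0 α with h | h
  · have := hp (α⁻¹ • x) fun q hq => by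
      rw [inner_smul_right, inv_mul_le_iff₀ h, mul_one]
      exact (hT q hq).le
    rw [inner_smul_right, inv_mul_le_iff₀ h] at this
    linarith
  · have hx : x = 0 := eq_zero_of_forall_smul_mem_closedBall hR fun t ht q hq => by
      rw [inner_smul_right]
      nlinarith [hT q hq]
    obtain ⟨v, hv⟩ := exists_ne (0 : E)
    refine hv (eq_zero_of_forall_smul_mem_closedBall hR fun t _ q hq => ?_)
    have := hT q hq
    rw [hx, inner_zero_right] at this
    linarith

theorem span_eq_top_of_innerPolar_subset_closedBall [FiniteDimensional ℝ E] {T : Set E} {R : ℝ}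
    (hR : innerPolar T ⊆ Metric.closedBall 0 R) : Submodule.span ℝ T = ⊤ := by
  rw [← Submodule.orthogonal_eq_bot_iff, eq_bot_iff]
  intro x hx
  refine eq_zero_of_forall_smul_mem_closedBall hR fun t _ q hq => ?_
  rw [inner_smul_right, (Submodule.mem_orthogonal _ _).1 hx q (Submodule.subset_span hq)]
  simp

open Module in
/-- If the polar `K` of a finite set satisfies `-K ⊆ d • K`, then at most `2 * d` of the
constraints cut out a body contained in `(d ^ 2 + 2 * d) • K`. -/
theorem exists_subset_forall_smul_mem_innerPolar [FiniteDimensional ℝ E] (hd : 1 ≤ finrank ℝ E)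
    {T : Finset E} {R : ℝ} (hR : innerPolar (T : Set E) ⊆ Metric.closedBall 0 R)
    (hneg : ∀ u ∈ innerPolar (T : Set E), -(1 / (finrank ℝ E : ℝ)) • u ∈ innerPolar (T : Set E)) :
    ∃ G ⊆ T, G.card ≤ 2 * finrank ℝ E ∧ ∀ u ∈ innerPolar (G : Set E),
      ((finrank ℝ E : ℝ) ^ 2 + 2 * finrank ℝ E)⁻¹ • u ∈ innerPolar (T : Set E) := by
  classical
  have : Nontrivial E := Module.nontrivial_of_finrank_pos (R := ℝ) hd
  have hd0 : (0 : ℝ) < finrank ℝ E := by exact_mod_cast hd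
  obtain ⟨b, hbT, hb⟩ := exists_basis_abs_repr_le_one T.finite_toSet.isCompact
    (span_eq_top_of_innerPolar_subset_closedBall hR)
  have hcard : (Fintype.card (Fin (finrank ℝ E)) : ℝ) = finrank ℝ E := by simp
  set n : ℝ := (finrank ℝ E : ℝ)
  have hbneg : ∀ i, -(1 / n) • b i ∈ convexHull ℝ (T : Set E) := fun i =>
    mem_convexHull_of_forall_mem_innerPolar hR fun x hx => by
      have := hneg x hx (b i) (hbT i)
      rwa [real_inner_smul_left, ← real_inner_smul_right]
  have hy : ∑ i, (1 / n) • (-(1 / n) • b i) ∈ convexHull ℝ (T : Set E) :=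
    (convex_convexHull ℝ _).sum_mem (fun _ _ => by positivity)
      (by rw [Finset.sum_const, Finset.card_univ, nsmul_eq_mul, hcard]; field_simp)
      fun i _ => hbneg i
  obtain ⟨w, hw0, hw1, hwy⟩ := Finset.mem_convexHull'.1 hy
  obtain ⟨S, hST, hScard, w', hw'0, hw'y, hw'1⟩ :=
    exists_conic_combination_card_le_finrank T w hw0
  rw [hwy] at hw'y
  rw [hw1] at hw'1
  refine ⟨S ∪ Finset.univ.image b, Finset.union_subset hST ?_, ?_, fun u hu q hq => ?_⟩
  · intro x hx
    obtain ⟨i, -, rfl⟩ := Finset.mem_image.1 hx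
    exact hbT i
  · have := Finset.card_union_le S (Finset.univ.image b)
    have h2 := Finset.card_image_le (s := Finset.univ) (f := b)
    simp only [Finset.card_univ, Fintype.card_fin] at h2
    omega
  · have hβ : ∀ i, inner ℝ (b i) u ≤ 1 := fun i => hu _ (by simp)
    have hS : ∀ s ∈ S, inner ℝ s u ≤ 1 := fun s hs => hu _ (by simp [hs])
    have hyu : inner ℝ (∑ s ∈ S, w' s • s) u ≤ 1 := by
      rw [sum_inner]
      refine le_trans (Finset.sum_le_sum fun s hs => ?_) hw'1
      rw [real_inner_smul_left]
      exact mul_le_of_le_one_right (hw'0 s hs) (hS s hs)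
    have hsum : -∑ i, inner ℝ (b i) u ≤ n ^ 2 := by
      rw [hw'y, sum_inner] at hyu
      simp only [real_inner_smul_left] at hyu
      rw [← Finset.mul_sum, ← Finset.mul_sum] at hyu
      field_simp at hyu
      linarith
    have hqu : inner ℝ q u ≤ n ^ 2 + 2 * n := by
      have hq' := b.sum_repr q
      calc inner ℝ q u = ∑ i, b.repr q i * inner ℝ (b i) u := by
            conv_lhs => rw [← hq']
            rw [sum_inner]
            simp only [real_inner_smul_left]
        _ ≤ ∑ i, (2 - inner ℝ (b i) u) := by
            refine Finset.sum_le_sum fun i _ => ?_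
            have h := abs_le.1 (hb q hq i)
            nlinarith [mul_nonneg (by linarith : 0 ≤ b.repr q i + 1) (sub_nonneg.2 (hβ i))]
        _ ≤ n ^ 2 + 2 * n := by
            rw [Finset.sum_sub_distrib, Finset.sum_const, Finset.card_univ, nsmul_eq_mul, hcard]
            linarith
    rw [inner_smul_right, inv_mul_le_iff₀ (by positivity), mul_one]
    exact hqu

open Module in
/-- Among finitely many linear constraints cutting out a body of radius at most `R`, some
`2 * d` constraints cut out a body of radius at most `(2 * (d ^ 2 + 2 * d) - 1) * R`. -/
theorem exists_subset_innerPolar_subset_closedBall [FiniteDimensional ℝ E]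
    (hd : 1 ≤ finrank ℝ E) {F : Finset E} {R : ℝ}
    (hR : innerPolar (F : Set E) ⊆ Metric.closedBall 0 R) :
    ∃ G ⊆ F, G.card ≤ 2 * finrank ℝ E ∧ innerPolar (G : Set E) ⊆
      Metric.closedBall 0 ((2 * ((finrank ℝ E : ℝ) ^ 2 + 2 * finrank ℝ E) - 1) * R) := by
  classical
  have hd1 : (1 : ℝ) ≤ finrank ℝ E := by exact_mod_cast hd
  have hcomp : IsCompact (innerPolar (F : Set E)) :=
    (isCompact_closedBall (0 : E) R).of_isClosed_subset (isClosed_innerPolar _) hR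
  obtain ⟨z, hz, hzK⟩ := exists_mem_forall_sub_smul_sub_mem hd hcomp (convex_innerPolar _)
    (zero_mem_innerPolar _) (exists_pos_smul_mem_innerPolar F)
  have hzR : ‖z‖ ≤ R := mem_closedBall_zero_iff.1 (hR hz)
  have hc : ∀ q ∈ F, 0 < 1 - inner ℝ q z := by
    intro q hq
    have h := hzK 0 (zero_mem_innerPolar _) q hq
    rw [zero_sub, smul_neg, sub_neg_eq_add, inner_add_right, inner_smul_right] at h
    by_contra! hle
    have h1 : (1 : ℝ) ≤ inner ℝ q z := by linarith
    have : 0 < 1 / (finrank ℝ E : ℝ) * inner ℝ q z := by positivity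
    linarith
  let φ : E → E := fun q => (1 - inner ℝ q z)⁻¹ • q
  have hφ : ∀ q ∈ F, ∀ u, inner ℝ (φ q) u ≤ 1 ↔ inner ℝ q (z + u) ≤ 1 := by
    intro q hq u
    rw [real_inner_smul_left, inv_mul_le_iff₀ (hc q hq), inner_add_right, mul_one,
      le_sub_iff_add_le']
  have hT : ∀ u, u ∈ innerPolar (F.image φ : Set E) ↔ z + u ∈ innerPolar (F : Set E) := by
    intro u
    simp only [mem_innerPolar, Finset.mem_coe, Finset.forall_mem_image]
    exact forall₂_congr fun q hq => hφ q hq u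
  have hTR : innerPolar (F.image φ : Set E) ⊆ Metric.closedBall 0 (R + R) := by
    intro u hu
    have h := mem_closedBall_zero_iff.1 (hR ((hT u).1 hu))
    rw [mem_closedBall_zero_iff]
    calc ‖u‖ = ‖(z + u) - z‖ := by rw [add_sub_cancel_left]
      _ ≤ R + R := (norm_sub_le _ _).trans (add_le_add h hzR)
  obtain ⟨G, hGT, hGcard, hG⟩ := exists_subset_forall_smul_mem_innerPolar hd hTR fun u hu => by
    rw [hT] at hu ⊢
    simpa [sub_eq_add_neg] using hzK _ hu
  have hpre : ∀ t ∈ G, ∃ q ∈ F, φ q = t := fun t ht => Finset.mem_image.1 (hGT ht)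
  choose! g hgF hg using hpre
  refine ⟨G.image g, Finset.image_subset_iff.2 hgF, Finset.card_image_le.trans hGcard,
    fun x hx => ?_⟩
  have hu : x - z ∈ innerPolar (G : Set E) := by
    intro t ht
    rw [← hg t ht, hφ _ (hgF t ht), add_sub_cancel]
    exact hx _ (by simpa using ⟨t, ht, rfl⟩)
  have h := mem_closedBall_zero_iff.1 (hR ((hT _).1 (hG _ hu)))
  set c : ℝ := (finrank ℝ E : ℝ) ^ 2 + 2 * finrank ℝ E
  have hc1 : 1 ≤ c := by simp only [c]; nlinarith
  have hx' : x = c • (z + c⁻¹ • (x - z)) - (c - 1) • z := by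
    rw [smul_add, smul_smul, mul_inv_cancel₀ (by positivity), one_smul, sub_smul, one_smul]
    abel
  rw [mem_closedBall_zero_iff]
  calc ‖x‖ = ‖c • (z + c⁻¹ • (x - z)) - (c - 1) • z‖ := by rw [← hx']
    _ ≤ c * ‖z + c⁻¹ • (x - z)‖ + (c - 1) * ‖z‖ := by
        refine (norm_sub_le _ _).trans_eq ?_
        rw [norm_smul, norm_smul, Real.norm_of_nonneg (by linarith),
          Real.norm_of_nonneg (by linarith : 0 ≤ c - 1)]
    _ ≤ c * R + (c - 1) * R := by gcongr
    _ = (2 * c - 1) * R := by ring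

/-- Finitely many points of a set whose convex hull contains the unit ball have a polar of radius
close to `1`. -/
theorem exists_finset_innerPolar_subset_closedBall [FiniteDimensional ℝ E] {Q : Set E}
    (hQ : Metric.closedBall (0 : E) 1 ⊆ convexHull ℝ Q) :
    ∃ F : Finset E, ↑F ⊆ Q ∧ innerPolar (F : Set E) ⊆ Metric.closedBall 0 (6 / 5) := by
  classical
  obtain ⟨t, htB, htfin, hcov⟩ :=
    (isCompact_closedBall (0 : E) 1).finite_cover_balls (show (0 : ℝ) < 1 / 6 by norm_num)
  have hfin : ∀ p ∈ t, ∃ s : Finset E, ↑s ⊆ Q ∧ p ∈ convexHull ℝ (s : Set E) := by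
    intro p hp
    have h := hQ (htB hp)
    rw [convexHull_eq_union_convexHull_finite_subsets] at h
    simpa using h
  choose! s hsQ hs using hfin
  refine ⟨htfin.toFinset.biUnion s, by simpa using hsQ, fun x hx => ?_⟩
  rw [mem_closedBall_zero_iff]
  rcases eq_or_ne x 0 with rfl | hx0
  · norm_num
  have hpos : 0 < ‖x‖ := norm_pos_iff.2 hx0
  have hunit : ‖‖x‖⁻¹ • x‖ = 1 := norm_smul_inv_norm hx0
  obtain ⟨p, hp, hxp⟩ := Set.mem_iUnion₂.1 (hcov (mem_closedBall_zero_iff.2 hunit.le))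
  rw [mem_ball_iff_norm] at hxp
  have hpx : inner ℝ p x ≤ 1 := by
    have hmem : x ∈ innerPolar (s p : Set E) := fun q hq =>
      hx q (by simpa using ⟨p, hp, hq⟩)
    rw [← innerPolar_convexHull] at hmem
    exact hmem p (hs p hp)
  have h1 : inner ℝ (‖x‖⁻¹ • x) x = ‖x‖ := by
    rw [real_inner_smul_left, real_inner_self_eq_norm_sq]
    field_simp
  have h2 := real_inner_le_norm (‖x‖⁻¹ • x - p) x
  rw [inner_sub_left, h1] at h2
  nlinarith [mul_le_mul_of_nonneg_right hxp.le hpos.le]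

end Polar

theorem quantitative_steinitz (d : ℕ) (hd : 1 ≤ d) (Q : Set (EuclideanSpace ℝ (Fin d)))
    (hQ : Metric.closedBall (0 : EuclideanSpace ℝ (Fin d)) 1 ⊆ convexHull ℝ Q) :
    ∃ F : Finset (EuclideanSpace ℝ (Fin d)), ↑F ⊆ Q ∧ F.card ≤ 2 * d ∧
      (1 / (6 * (d : ℝ) ^ 2)) • Metric.closedBall (0 : EuclideanSpace ℝ (Fin d)) 1 ⊆
        convexHull ℝ (F : Set (EuclideanSpace ℝ (Fin d))) := by
  have hfr : Module.finrank ℝ (EuclideanSpace ℝ (Fin d)) = d := by simp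
  have : Nontrivial (EuclideanSpace ℝ (Fin d)) :=
    Module.nontrivial_of_finrank_pos (R := ℝ) (by omega)
  have hd1 : (1 : ℝ) ≤ d := by exact_mod_cast hd
  obtain ⟨F, hFQ, hF⟩ := exists_finset_innerPolar_subset_closedBall hQ
  obtain ⟨G, hGF, hGcard, hG⟩ := exists_subset_innerPolar_subset_closedBall (by omega) hF
  rw [hfr] at hGcard hG
  refine ⟨G, (Finset.coe_subset.2 hGF).trans hFQ, hGcard, ?_⟩
  rintro _ ⟨v, hv, rfl⟩
  refine mem_convexHull_of_forall_mem_innerPolar hG fun x hx => ?_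
  have hv1 : ‖v‖ ≤ 1 := mem_closedBall_zero_iff.1 hv
  have hx1 : ‖x‖ ≤ 6 * (d : ℝ) ^ 2 := by
    refine (mem_closedBall_zero_iff.1 (hG hx)).trans ?_
    nlinarith
  simp only [real_inner_smul_left]
  rw [one_div, inv_mul_le_iff₀ (by positivity), mul_one]
  calc inner ℝ v x ≤ ‖v‖ * ‖x‖ := real_inner_le_norm v x
    _ ≤ 1 * (6 * (d : ℝ) ^ 2) := by gcongr
    _ = 6 * (d : ℝ) ^ 2 := one_mul _
end

section
/- Let Q ⊆ ℝ^d be a convex polytope containing the Euclidean unit ball B^d. Then there exist at most 2d vertices of Q whose convex hull Q' satisfies (1/(5d²))·B^d ⊆ Q'. -/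
open Pointwise

section Steinitz

open Module Set

variable {E : Type*}

/-- A finite spanning set contains a basis in which all its elements have coordinates in `[-1, 1]`:
take one of maximal determinant. -/
theorem exists_basis_abs_repr_le_one_s2 [AddCommGroup E] [Module ℝ E] [FiniteDimensional ℝ E]
    (W : Finset E) (hW : Submodule.span ℝ (W : Set E) = ⊤) :
    ∃ b : Basis (Fin (finrank ℝ E)) ℝ E,
      (∀ i, b i ∈ W) ∧ ∀ w ∈ W, ∀ i, |b.repr w i| ≤ 1 := by
  classical
  obtain ⟨e, he⟩ : ∃ e : Basis (Fin (finrank ℝ E)) ℝ E, ∀ i, e i ∈ W := by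
    let e₀ := Basis.ofSpan hW.ge
    refine ⟨e₀.reindex (e₀.indexEquiv (finBasis ℝ E)), fun i => ?_⟩
    rw [Basis.reindex_apply]
    exact Basis.ofSpan_subset hW.ge (mem_range_self _)
  have : Nonempty (Fin (finrank ℝ E) → W) := ⟨fun i => ⟨e i, he i⟩⟩
  obtain ⟨f, hf⟩ := Finite.exists_max fun f : Fin (finrank ℝ E) → W => |e.det fun i => (f i : E)|
  have h_pos : 0 < |e.det fun i => (f i : E)| := by
    refine lt_of_lt_of_le one_pos ?_
    have h := hf fun i => ⟨e i, he i⟩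
    rwa [show e.det (fun i => e i) = 1 from e.det_self, abs_one] at h
  obtain ⟨hli, hsp⟩ := (e.is_basis_iff_det (v := fun i => (f i : E))).2
    (isUnit_iff_ne_zero.2 (abs_pos.1 h_pos))
  refine ⟨Basis.mk hli hsp.ge, fun i => by simp, fun w hw i => ?_⟩
  have h := congrArg (fun φ => φ w) (e.det_smul_mk_coord_eq_det_update hli hsp.ge i)
  simp only [LinearMap.smul_apply, smul_eq_mul, Basis.coord_apply,
    MultilinearMap.toLinearMap_apply] at h
  have hm := hf (Function.update f i ⟨w, hw⟩)
  have hu : (fun j => ((Function.update f i ⟨w, hw⟩ : Fin (finrank ℝ E) → W) j : E)) =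
      Function.update (fun j => (f j : E)) i w := by
    ext j
    by_cases hj : j = i
    · subst hj; simp
    · simp [hj]
  rw [hu] at hm
  replace h : |e.det fun i => (f i : E)| * |(Basis.mk hli hsp.ge).repr w i| =
      |e.det (Function.update (fun j => (f j : E)) i w)| := by
    rw [← abs_mul]; exact congrArg _ h
  rw [← h] at hm
  exact le_of_mul_le_mul_left (by linarith) h_pos

/-- The point where a ray leaves the convex hull of a finite set is a convex combination of at most
`finrank ℝ E` points of the set. -/
theorem exists_smul_mem_convexHull_card_le_finrank [NormedAddCommGroup E] [NormedSpace ℝ E]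
    [FiniteDimensional ℝ E] (W : Finset E) {x : E} (hx : x ≠ 0) {s : ℝ}
    (hs : s • x ∈ convexHull ℝ (W : Set E)) :
    ∃ t, s ≤ t ∧ ∃ T ⊆ W, T.card ≤ finrank ℝ E ∧ t • x ∈ convexHull ℝ (T : Set E) := by
  classical
  have hc : IsCompact (convexHull ℝ (W : Set E)) := W.finite_toSet.isCompact_convexHull ℝ
  have hK : IsCompact ((fun t : ℝ => t • x) ⁻¹' convexHull ℝ (W : Set E)) :=
    (isClosedEmbedding_smul_left hx).isCompact_preimage hc
  obtain ⟨t, ht, htmax⟩ := hK.exists_isMaxOn ⟨s, hs⟩ continuous_id.continuousOn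
  refine ⟨t, htmax hs, ?_⟩
  obtain ⟨ι, _, z, w, hzW, hz, hw, hw1, hwx⟩ := eq_pos_convex_span_of_mem_convexHull ht
  replace hwx : ∑ i, w i • z i = t • x := hwx
  have hmem : ∀ i, z i ∈ W := fun i => hzW (mem_range_self i)
  refine ⟨Finset.univ.image z, fun v hv => ?_, ?_, ?_⟩
  · obtain ⟨i, -, rfl⟩ := Finset.mem_image.1 hv
    exact hmem i
  · refine Finset.card_image_le.trans ?_
    rw [Finset.card_univ]
    by_contra! hcard
    have hle := hz.card_le_finrank_succ
    have hle' : finrank ℝ (vectorSpan ℝ (range z)) ≤ finrank ℝ E := Submodule.finrank_le _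
    have htop : affineSpan ℝ (range z) = ⊤ :=
      hz.affineSpan_eq_top_iff_card_eq_finrank_add_one.2 (by omega)
    let b : AffineBasis ι ℝ E := ⟨z, hz, htop⟩
    have hint : t • x ∈ interior (convexHull ℝ (W : Set E)) := by
      refine interior_mono (convexHull_mono hzW) ?_
      have := b.interior_convexHull
      change interior (convexHull ℝ (range z)) = _ at this
      rw [this]
      intro i
      have hcomb : Finset.univ.affineCombination ℝ b w = t • x := by
        rw [Finset.affineCombination_eq_linear_combination _ _ _ hw1]
        exact hwx
      rw [← hcomb, b.coord_apply_combination_of_mem (Finset.mem_univ i) hw1]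
      exact hw i
    have hev : ∀ᶠ r in nhds t, r • x ∈ convexHull ℝ (W : Set E) :=
      (continuous_id.smul continuous_const).continuousAt (mem_interior_iff_mem_nhds.1 hint)
    obtain ⟨r, hr, hrt⟩ := ((hev.filter_mono nhdsWithin_le_nhds).and
      (self_mem_nhdsWithin (s := Ioi t))).exists
    exact absurd (htmax hr) (not_le.2 hrt)
  · rw [← hwx, Finset.coe_image, Finset.coe_univ, image_univ]
    exact (convex_convexHull ℝ _).sum_mem (fun i _ => (hw i).le) hw1
      fun i _ => subset_convexHull ℝ _ (mem_range_self i)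

/-- A compact convex body has a centre `c` for which its Minkowski measure of asymmetry is at most
`finrank ℝ E`. -/
theorem IsCompact.exists_center_sub_smul_mem [NormedAddCommGroup E] [NormedSpace ℝ E]
    [FiniteDimensional ℝ E] [Nontrivial E] {P : Set E} (hP : IsCompact P) (hconv : Convex ℝ P)
    (hne : P.Nonempty) :
    ∃ c ∈ P, ∀ x ∈ P, c - (finrank ℝ E : ℝ)⁻¹ • (x - c) ∈ P := by
  classical
  set n : ℝ := (finrank ℝ E : ℝ) with hn
  have hn0 : 0 < n := by rw [hn]; exact_mod_cast finrank_pos (R := ℝ) (M := E)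
  have hn1 : n + 1 ≠ 0 := by positivity
  let F : P → Set E := fun x => (fun p : E => (n + 1)⁻¹ • (n • p + (x : E))) '' P
  have hcont : ∀ x : P, Continuous fun p : E => (n + 1)⁻¹ • (n • p + (x : E)) := fun x => by
    fun_prop
  have hF : (⋂ x, F x).Nonempty := by
    refine Convex.helly_theorem_compact' (𝕜 := ℝ) (fun x => ?_) (fun x => hP.image (hcont x))
      fun I hI => ?_
    · rintro _ ⟨p, hp, rfl⟩ _ ⟨q, hq, rfl⟩ a b ha hb hab
      refine ⟨a • p + b • q, hconv hp hq ha hb hab, ?_⟩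
      obtain rfl : b = 1 - a := by linarith
      module
    · obtain ⟨p₀, hp₀⟩ := hne
      set S : E := ∑ y ∈ I, (y : E) with hS
      have hcard : (I.card : ℝ) ≤ n + 1 := by rw [hn]; exact_mod_cast hI
      refine ⟨(n + 1)⁻¹ • (S + (n + 1 - I.card) • p₀), mem_iInter₂.2 fun x hx => ?_⟩
      refine ⟨n⁻¹ • (∑ y ∈ I.erase x, (y : E) + (n + 1 - I.card) • p₀), ?_, ?_⟩
      · have hce : ((I.erase x).card : ℝ) = I.card - 1 := by
          rw [Finset.card_erase_of_mem hx, Nat.cast_sub (Finset.card_pos.2 ⟨x, hx⟩)]; simp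
        have key : n⁻¹ • (∑ y ∈ I.erase x, (y : E) + (n + 1 - I.card) • p₀) =
            ∑ o ∈ (I.erase x).insertNone,
              (o.elim (n⁻¹ * (n + 1 - I.card)) fun _ => n⁻¹ : ℝ) •
                (o.elim p₀ fun y => (y : E) : E) := by
          rw [Finset.sum_insertNone]
          simp only [Option.elim_none, Option.elim_some]
          rw [← Finset.smul_sum, smul_add, smul_smul, add_comm]
        rw [key]
        refine hconv.sum_mem ?_ ?_ ?_
        · rintro (_ | y) -
          · exact mul_nonneg (by positivity) (by linarith)
          · exact (inv_pos.2 hn0).le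
        · rw [Finset.sum_insertNone]
          simp only [Option.elim_none, Option.elim_some, Finset.sum_const, nsmul_eq_mul, hce]
          field_simp
          ring
        · rintro (_ | y) -
          · exact hp₀
          · exact y.2
      · have : S = ∑ y ∈ I.erase x, (y : E) + x := (Finset.sum_erase_add _ _ hx).symm
        simp only [this, smul_inv_smul₀ hn0.ne']
        congr 1
        abel
  obtain ⟨c, hc⟩ := hF
  rw [mem_iInter] at hc
  refine ⟨c, ?_, fun x hx => ?_⟩
  · obtain ⟨x, hx⟩ := hne
    obtain ⟨p, hp, rfl⟩ := hc ⟨x, hx⟩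
    have := hconv hp hx (a := (n + 1)⁻¹ * n) (b := (n + 1)⁻¹) (by positivity) (by positivity)
      (by field_simp)
    simpa [smul_add, smul_smul] using this
  · obtain ⟨p, hp, rfl⟩ := hc ⟨x, hx⟩
    convert hp using 1
    simp only
    match_scalars
    · field_simp
      ring
    · field_simp
      ring

variable [NormedAddCommGroup E] [InnerProductSpace ℝ E]

theorem exists_inner_lt_of_notMem_convexHull [CompleteSpace E] {T : Set E} (hT : T.Finite) {x : E}
    (hx : x ∉ convexHull ℝ T) :
    ∃ (f : E) (s : ℝ), (∀ w ∈ T, inner ℝ f w < s) ∧ s < inner ℝ f x := by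
  obtain ⟨f, s, h₁, h₂⟩ := geometric_hahn_banach_closed_point (convex_convexHull ℝ T)
    (hT.isClosed_convexHull ℝ) hx
  refine ⟨(InnerProductSpace.toDual ℝ E).symm f, s, fun w hw => ?_, ?_⟩
  · simpa using h₁ w (subset_convexHull ℝ T hw)
  · simpa using h₂

/-- If the polar of a finite set lies in the ball of radius `R`, then its convex hull contains the
ball of radius `R⁻¹`. -/
theorem mem_convexHull_of_polar_bounded [CompleteSpace E] [Nontrivial E] {T : Set E}
    (hT : T.Finite) {R : ℝ}
    (hR : ∀ z : E, (∀ w ∈ T, inner ℝ z w ≤ 1) → ‖z‖ ≤ R) {x : E} (hx : R * ‖x‖ ≤ 1) :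
    x ∈ convexHull ℝ T := by
  by_contra hxT
  obtain ⟨f, s, hfs, hsx⟩ := exists_inner_lt_of_notMem_convexHull hT hxT
  rcases lt_or_ge 0 s with hs | hs
  · have hz := hR (s⁻¹ • f) fun w hw => by
      rw [real_inner_smul_left, inv_mul_le_iff₀ hs, mul_one]
      exact (hfs w hw).le
    have h₁ : 1 < inner ℝ (s⁻¹ • f) x := by
      rw [real_inner_smul_left, lt_inv_mul_iff₀ hs, mul_one]
      exact hsx
    have h₂ := real_inner_le_norm (s⁻¹ • f) x
    have h₃ := mul_le_mul_of_nonneg_right hz (norm_nonneg x)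
    linarith
  · rcases T.eq_empty_or_nonempty with rfl | ⟨w, hw⟩
    · obtain ⟨z, hz⟩ := NormedSpace.exists_lt_norm ℝ E R
      exact absurd (hR z (by simp)) (not_le.2 hz)
    · have hf : f ≠ 0 := by
        rintro rfl
        have := hfs w hw
        rw [inner_zero_left] at this
        linarith
      have hf' : 0 < ‖f‖ := norm_pos_iff.2 hf
      have hz := hR (((|R| + 1) / ‖f‖) • f) fun w hw => by
        rw [real_inner_smul_left]
        have h₁ : (|R| + 1) / ‖f‖ * inner ℝ f w ≤ 0 :=
          mul_nonpos_of_nonneg_of_nonpos (by positivity) ((hfs w hw).le.trans hs)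
        linarith
      rw [norm_smul, Real.norm_of_nonneg (by positivity), div_mul_cancel₀ _ hf'.ne'] at hz
      linarith [le_abs_self R]

/-- If the polar `K` of a finite spanning set satisfies `K ⊆ -n K`, then at most `2 n` of the points
already have polar contained in `(n ^ 2 + 2 n) K`. -/
theorem exists_subset_card_le_inner_le [FiniteDimensional ℝ E] [Nontrivial E] (W : Finset E)
    (hW : Submodule.span ℝ (W : Set E) = ⊤)
    (hK : ∀ z : E, (∀ w ∈ W, inner ℝ z w ≤ 1) →
      ∀ w ∈ W, inner ℝ (-(finrank ℝ E : ℝ)⁻¹ • z) w ≤ 1) :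
    ∃ T ⊆ W, T.card ≤ 2 * finrank ℝ E ∧ ∀ z : E, (∀ w ∈ T, inner ℝ z w ≤ 1) →
      ∀ w ∈ W, inner ℝ z w ≤ (finrank ℝ E : ℝ) ^ 2 + 2 * finrank ℝ E := by
  classical
  obtain ⟨b, hbW, hb⟩ := exists_basis_abs_repr_le_one_s2 W hW
  set n : ℝ := (finrank ℝ E : ℝ) with hn
  have hn0 : 0 < n := by rw [hn]; exact_mod_cast finrank_pos (R := ℝ) (M := E)
  have hK' : ∀ z : E, (∀ w ∈ W, inner ℝ z w ≤ 1) → ∀ w ∈ W, -n ≤ inner ℝ z w := by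
    intro z hz w hw
    have := hK z hz w hw
    rw [real_inner_smul_left, neg_mul, neg_le, ← div_eq_inv_mul, le_div_iff₀ hn0] at this
    linarith
  set u : E := ∑ i, b i with hu
  have hu0 : u ≠ 0 := by
    intro h
    have : Nonempty (Fin (finrank ℝ E)) := ⟨⟨0, finrank_pos⟩⟩
    obtain ⟨i⟩ := this
    have := Fintype.linearIndependent_iff.1 b.linearIndependent (fun _ => 1)
      (by simpa [hu] using h) i
    exact one_ne_zero this
  have hmem : (n ^ 2)⁻¹ • (-u) ∈ convexHull ℝ (W : Set E) := by
    by_contra hxW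
    obtain ⟨f, s, hfs, hsx⟩ := exists_inner_lt_of_notMem_convexHull W.finite_toSet hxW
    have hW0 : ∃ w, w ∈ W := ⟨_, hbW ⟨0, finrank_pos⟩⟩
    have hs : 0 < s := by
      by_contra! hs
      obtain ⟨w, hw⟩ := hW0
      have hfw : inner ℝ f w < 0 := (hfs w hw).trans_le hs
      have := hK' (((n + 1) / (-inner ℝ f w)) • f) (fun v hv => by
        rw [real_inner_smul_left]
        have h₁ : (n + 1) / (-inner ℝ f w) * inner ℝ f v ≤ 0 :=
          mul_nonpos_of_nonneg_of_nonpos (div_nonneg (by positivity) (by linarith))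
            ((hfs v hv).le.trans hs)
        linarith) w hw
      rw [real_inner_smul_left, div_neg, neg_mul, div_mul_cancel₀ _ hfw.ne] at this
      linarith
    have hz := hK' (s⁻¹ • f) fun w hw => by
      rw [real_inner_smul_left, inv_mul_le_iff₀ hs, mul_one]
      exact (hfs w hw).le
    have hsum : -(n ^ 2) ≤ inner ℝ (s⁻¹ • f) u := by
      rw [hu, inner_sum]
      calc -(n ^ 2) = ∑ _i : Fin (finrank ℝ E), -n := by simp [← hn]; ring
        _ ≤ _ := Finset.sum_le_sum fun i _ => hz _ (hbW i)
    have hlt : 1 < inner ℝ (s⁻¹ • f) ((n ^ 2)⁻¹ • (-u)) := by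
      rw [real_inner_smul_left, lt_inv_mul_iff₀ hs, mul_one]
      exact hsx
    rw [real_inner_smul_right, inner_neg_right, lt_inv_mul_iff₀ (by positivity)] at hlt
    linarith
  obtain ⟨t, hst, T, hTW, hTcard, htT⟩ :=
    exists_smul_mem_convexHull_card_le_finrank W (neg_ne_zero.2 hu0) hmem
  refine ⟨Finset.univ.image b ∪ T, ?_, ?_, fun z hz w hw => ?_⟩
  · refine Finset.union_subset (fun v hv => ?_) hTW
    obtain ⟨i, -, rfl⟩ := Finset.mem_image.1 hv
    exact hbW i
  · have h₁ := Finset.card_union_le (Finset.univ.image b) T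
    have h₂ : (Finset.univ.image b).card ≤ finrank ℝ E := by
      simpa using Finset.card_image_le (s := Finset.univ) (f := b)
    omega
  · have hzb : ∀ i, inner ℝ z (b i) ≤ 1 := fun i =>
      hz _ (Finset.mem_union_left _ (Finset.mem_image_of_mem _ (Finset.mem_univ i)))
    have hzt : inner ℝ z (t • (-u)) ≤ 1 := by
      have hsub : convexHull ℝ (T : Set E) ⊆ {y | innerₛₗ ℝ z y ≤ 1} :=
        convexHull_min (fun v hv => hz v (Finset.mem_union_right _ hv))
          (convex_halfSpace_le (innerₛₗ ℝ z).isLinear 1)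
      exact hsub htT
    have hzu : -(n ^ 2) ≤ inner ℝ z u := by
      rw [real_inner_smul_right, inner_neg_right] at hzt
      have ht0 : 0 < t := lt_of_lt_of_le (by positivity) hst
      have h₁ : -inner ℝ z u ≤ t⁻¹ := by rwa [← one_div, le_div_iff₀' ht0]
      have h₂ : t⁻¹ ≤ n ^ 2 := inv_le_of_inv_le₀ (by positivity) hst
      linarith
    have hrepr : inner ℝ z w = ∑ i, b.repr w i * inner ℝ z (b i) := by
      have h := congrArg (inner ℝ z) (b.sum_repr w)
      simpa only [inner_sum, real_inner_smul_right] using h.symm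
    have hterm : ∀ i, b.repr w i * inner ℝ z (b i) ≤ 2 - inner ℝ z (b i) := fun i => by
      have h := abs_le.1 (hb w hw i)
      nlinarith [hzb i, h.1, h.2]
    calc inner ℝ z w ≤ ∑ i, (2 - inner ℝ z (b i)) := by
          rw [hrepr]; exact Finset.sum_le_sum fun i _ => hterm i
      _ = 2 * n - inner ℝ z u := by
          rw [Finset.sum_sub_distrib, hu, inner_sum]; simp [← hn]; ring
      _ ≤ _ := by linarith

/-- If the polar of a finite set lies in the unit ball, then at most `2 n` of its points have
polar contained in a ball of radius `2 (n ^ 2 + 2 n) - 1`. -/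
theorem exists_subset_card_le_polar_bounded [FiniteDimensional ℝ E] [Nontrivial E] (V : Finset E)
    (hV : ∀ z : E, (∀ v ∈ V, inner ℝ z v ≤ 1) → ‖z‖ ≤ 1) :
    ∃ F ⊆ V, F.card ≤ 2 * finrank ℝ E ∧ ∀ z : E, (∀ v ∈ F, inner ℝ z v ≤ 1) →
      ‖z‖ ≤ 2 * ((finrank ℝ E : ℝ) ^ 2 + 2 * finrank ℝ E) - 1 := by
  classical
  let P : Set E := {z | ∀ v ∈ V, inner ℝ z v ≤ 1}
  have hPeq : P = ⋂ v ∈ V, {z | inner ℝ z v ≤ 1} := by ext; simp [P]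
  have hPclosed : IsClosed P := by
    rw [hPeq]
    exact isClosed_biInter fun v _ => isClosed_le (by fun_prop) continuous_const
  have hPcompact : IsCompact P := Metric.isCompact_of_isClosed_isBounded hPclosed
    ((Metric.isBounded_closedBall (x := (0 : E)) (r := 1)).subset fun z hz => by
      simpa using hV z hz)
  have hPconvex : Convex ℝ P := by
    intro x hx y hy a b ha hb hab v hv
    rw [inner_add_left, real_inner_smul_left, real_inner_smul_left]
    nlinarith [hx v hv, hy v hv]
  have h0 : (0 : E) ∈ P := fun v _ => by simp
  obtain ⟨c, hcP, hc⟩ := hPcompact.exists_center_sub_smul_mem hPconvex ⟨0, h0⟩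
  set n : ℝ := (finrank ℝ E : ℝ) with hn
  have hn0 : 0 < n := by rw [hn]; exact_mod_cast finrank_pos (R := ℝ) (M := E)
  have hcV : ∀ v ∈ V, 0 < 1 - inner ℝ c v := fun v hv => by
    have h := hc 0 h0 v hv
    rw [zero_sub, smul_neg, sub_neg_eq_add, inner_add_left, real_inner_smul_left] at h
    by_contra! hcon
    have : 0 < n⁻¹ * inner ℝ c v := mul_pos (by positivity) (by linarith)
    linarith
  let g : E → E := fun v => (1 - inner ℝ c v)⁻¹ • v
  have hg : ∀ v ∈ V, ∀ z, inner ℝ z (g v) ≤ 1 ↔ inner ℝ (c + z) v ≤ 1 := fun v hv z => by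
    simp only [g]
    rw [real_inner_smul_right, inv_mul_le_iff₀ (hcV v hv), inner_add_left]
    constructor <;> intro h <;> linarith
  have hpolar : ∀ z, (∀ w ∈ V.image g, inner ℝ z w ≤ 1) ↔ c + z ∈ P := fun z => by
    rw [Finset.forall_mem_image]
    exact forall₂_congr fun v hv => hg v hv z
  have hspan : Submodule.span ℝ ((V.image g : Finset E) : Set E) = ⊤ := by
    rw [← Submodule.orthogonal_eq_bot_iff, Submodule.eq_bot_iff]
    intro f hf
    by_contra hf0
    have hf' : 0 < ‖f‖ := norm_pos_iff.2 hf0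
    have hfv : ∀ v ∈ V, inner ℝ f v = 0 := fun v hv => by
      have := (Submodule.mem_orthogonal' _ _).1 hf (g v)
        (Submodule.subset_span (Finset.mem_coe.2 (Finset.mem_image_of_mem g hv)))
      simp only [g] at this
      rw [real_inner_smul_right] at this
      exact (mul_eq_zero.1 this).resolve_left (inv_ne_zero (hcV v hv).ne')
    have := hV ((2 / ‖f‖) • f) fun v hv => by
      rw [real_inner_smul_left, hfv v hv]; norm_num
    rw [norm_smul, Real.norm_of_nonneg (by positivity), div_mul_cancel₀ _ hf'.ne'] at this
    norm_num at this
  obtain ⟨T, hTW, hTcard, hT⟩ := exists_subset_card_le_inner_le (V.image g) hspan fun z hz => by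
    rw [hpolar] at hz ⊢
    have := hc _ hz
    rwa [add_sub_cancel_left, sub_eq_add_neg, ← neg_smul] at this
  choose! h hhV hgh using fun w (hw : w ∈ T) => Finset.mem_image.1 (hTW hw)
  refine ⟨T.image h, fun v hv => ?_, Finset.card_image_le.trans hTcard, fun z hz => ?_⟩
  · obtain ⟨w, hw, rfl⟩ := Finset.mem_image.1 hv
    exact hhV w hw
  · rw [← hn] at hT
    set k : ℝ := n ^ 2 + 2 * n with hk
    have hk1 : 1 ≤ k := by
      have : 1 ≤ n := by rw [hn]; exact_mod_cast finrank_pos (R := ℝ) (M := E)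
      nlinarith
    have hk0 : 0 < k := by linarith
    have hzc : ∀ w ∈ V.image g, inner ℝ (z - c) w ≤ k := hT (z - c) fun w hw => by
      rw [← hgh w hw, hg _ (hhV w hw), add_sub_cancel]
      exact hz _ (Finset.mem_image_of_mem h hw)
    have hp : c + k⁻¹ • (z - c) ∈ P := (hpolar _).1 fun w hw => by
      rw [real_inner_smul_left, inv_mul_le_iff₀ hk0, mul_one]
      exact hzc w hw
    have hz' : z = k • (c + k⁻¹ • (z - c)) - (k - 1) • c := by
      rw [smul_add, smul_inv_smul₀ hk0.ne']; module
    calc ‖z‖ ≤ ‖k • (c + k⁻¹ • (z - c))‖ + ‖(k - 1) • c‖ := by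
          conv_lhs => rw [hz']
          exact norm_sub_le _ _
      _ ≤ k * 1 + (k - 1) * 1 := by
          rw [norm_smul, norm_smul, Real.norm_of_nonneg hk0.le,
            Real.norm_of_nonneg (sub_nonneg.2 hk1)]
          gcongr
          · exact hV _ hp
          · exact hV _ hcP
      _ = 2 * k - 1 := by ring

end Steinitz

theorem convexHull_extremePoints_convexHull {E : Type*} [NormedAddCommGroup E] [NormedSpace ℝ E]
    {V : Set E} (hV : V.Finite) :
    convexHull ℝ ((convexHull ℝ V).extremePoints ℝ) = convexHull ℝ V := by
  have hfin : ((convexHull ℝ V).extremePoints ℝ).Finite :=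
    hV.subset extremePoints_convexHull_subset
  rw [← (hfin.isClosed_convexHull ℝ).closure_eq]
  exact closure_convexHull_extremePoints (hV.isCompact_convexHull ℝ) (convex_convexHull ℝ V)

theorem quantitative_steinitz_polytope (d : ℕ) (hd : 2 ≤ d)
    (V : Finset (EuclideanSpace ℝ (Fin d)))
    (Q : Set (EuclideanSpace ℝ (Fin d)))
    (hQpoly : Q = convexHull ℝ (V : Set (EuclideanSpace ℝ (Fin d))))
    (hQ : Metric.closedBall (0 : EuclideanSpace ℝ (Fin d)) 1 ⊆ Q) :
    ∃ F : Finset (EuclideanSpace ℝ (Fin d)),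
      (F : Set (EuclideanSpace ℝ (Fin d))) ⊆ Q.extremePoints ℝ ∧ F.card ≤ 2 * d ∧
      (1 / (5 * (d : ℝ) ^ 2)) • Metric.closedBall (0 : EuclideanSpace ℝ (Fin d)) 1 ⊆
        convexHull ℝ (F : Set (EuclideanSpace ℝ (Fin d))) := by
  have hrank : Module.finrank ℝ (EuclideanSpace ℝ (Fin d)) = d := finrank_euclideanSpace_fin
  have : Nontrivial (EuclideanSpace ℝ (Fin d)) :=
    Module.nontrivial_of_finrank_pos (R := ℝ) (by omega)
  have hd' : (2 : ℝ) ≤ d := by exact_mod_cast hd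
  have hfin : (Q.extremePoints ℝ).Finite := by
    rw [hQpoly]; exact V.finite_toSet.subset extremePoints_convexHull_subset
  have hQext : convexHull ℝ (Q.extremePoints ℝ) = Q := by
    rw [hQpoly]; exact convexHull_extremePoints_convexHull V.finite_toSet
  obtain ⟨F, hFV, hFcard, hF⟩ := exists_subset_card_le_polar_bounded hfin.toFinset fun z hz => by
    rcases eq_or_ne z 0 with rfl | hz0
    · simp
    have hz' : ‖z‖ ≠ 0 := norm_ne_zero_iff.2 hz0
    have hmem : ‖z‖⁻¹ • z ∈ Q := hQ (by simp [norm_smul, hz'])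
    have hsub : convexHull ℝ (Q.extremePoints ℝ) ⊆ {y | innerₛₗ ℝ z y ≤ 1} :=
      convexHull_min (fun v hv => hz v (hfin.mem_toFinset.2 hv))
        (convex_halfSpace_le (innerₛₗ ℝ z).isLinear 1)
    have h : inner ℝ z (‖z‖⁻¹ • z) ≤ 1 := hsub (hQext.symm ▸ hmem)
    rwa [real_inner_smul_right, real_inner_self_eq_norm_sq, sq, inv_mul_cancel_left₀ hz'] at h
  rw [hrank] at hFcard hF
  refine ⟨F, fun v hv => hfin.mem_toFinset.1 (hFV hv), hFcard, ?_⟩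
  rintro _ ⟨x, hx, rfl⟩
  refine mem_convexHull_of_polar_bounded F.finite_toSet (R := 5 * (d : ℝ) ^ 2)
    (fun z hz => (hF z hz).trans (by nlinarith)) ?_
  have hx1 : ‖x‖ ≤ 1 := by simpa using hx
  simp only [norm_smul]
  rw [Real.norm_of_nonneg (by positivity), ← mul_assoc, mul_one_div_cancel (by positivity), one_mul]
  exact hx1
end

section
/- Let u_1, …, u_n be unit vectors in ℝ^d. Then for every ε > 0, the convex hull of {±u_1, …, ±u_n} does not contain the ball (√n/d + ε)·B^d. -/
open Pointwise

open scoped RealInnerProductSpace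

section Polytope

variable {E κ : Type*} [NormedAddCommGroup E] [InnerProductSpace ℝ E]

/-- If the absolute convex hull of `u` contains the ball of radius `r`, then the norm of `x` is
controlled by the inner products `⟪u i, x⟫`. -/
lemma mul_norm_le_of_closedBall_subset (u : κ → E) {r : ℝ} (hr : 0 ≤ r)
    (h : Metric.closedBall (0 : E) r ⊆
      convexHull ℝ (Set.range u ∪ Set.range (fun i => -u i)))
    {x : E} {c : ℝ} (hx : ∀ i, |⟪u i, x⟫| ≤ c) : r * ‖x‖ ≤ c := by
  have hhull : convexHull ℝ (Set.range u ∪ Set.range (fun i => -u i)) ⊆ {y | ⟪x, y⟫ ≤ c} := by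
    refine convexHull_min ?_ (convex_halfSpace_le (innerₛₗ ℝ x).isLinear c)
    rintro y (⟨i, rfl⟩ | ⟨i, rfl⟩)
    · simpa [real_inner_comm] using (abs_le.1 (hx i)).2
    · have := (abs_le.1 (hx i)).1
      rw [Set.mem_ofPred_eq, inner_neg_right, real_inner_comm]
      linarith
  have hmem : (r * ‖x‖⁻¹) • x ∈ Metric.closedBall (0 : E) r := by
    rw [mem_closedBall_zero_iff, norm_smul, Real.norm_of_nonneg (by positivity), mul_assoc]
    exact mul_le_of_le_one_right hr inv_mul_le_one
  have hle : ⟪x, (r * ‖x‖⁻¹) • x⟫ ≤ c := hhull (h hmem)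
  rw [inner_smul_right, real_inner_self_eq_norm_sq] at hle
  rcases eq_or_ne ‖x‖ 0 with h0 | h0
  · simpa [h0] using hle
  · calc r * ‖x‖ = r * ‖x‖⁻¹ * ‖x‖ ^ 2 := by field_simp
      _ ≤ c := hle

variable [Fintype κ]

/-- A point of `{y ∈ W | ∀ i, |⟪u i, y⟫| ≤ 1}` which is not the midpoint of a nontrivial segment
of that set has at least `dim W` active constraints. -/
lemma finrank_le_sum_inner_sq_of_extreme (u : κ → E) (W : Submodule ℝ E) {x : E}
    (hx : ∀ i, |⟪u i, x⟫| ≤ 1)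
    (hext : ∀ v ∈ W, (∀ i, |⟪u i, x + v⟫| ≤ 1) → (∀ i, |⟪u i, x - v⟫| ≤ 1) → v = 0) :
    (Module.finrank ℝ W : ℝ) ≤ ∑ i, ⟪u i, x⟫ ^ 2 := by
  classical
  set S : Finset κ := Finset.univ.filter (fun i => |⟪u i, x⟫| = 1) with hS
  let L : W →ₗ[ℝ] (S → ℝ) := LinearMap.pi fun i => (innerₛₗ ℝ (u i)).comp W.subtype
  have hL : Function.Injective L := by
    rw [injective_iff_map_eq_zero]
    intro v hv
    have hv0 : ∀ i ∈ S, ⟪u i, (v : E)⟫ = 0 := fun i hi => congrFun hv ⟨i, hi⟩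
    have hsmall : ∀ i, ∀ᶠ δ : ℝ in nhds 0,
        |⟪u i, x + δ • (v : E)⟫| ≤ 1 ∧ |⟪u i, x - δ • (v : E)⟫| ≤ 1 := by
      intro i
      by_cases hi : i ∈ S
      · refine Filter.Eventually.of_forall fun δ => ?_
        simpa [inner_add_right, inner_sub_right, inner_smul_right, hv0 i hi] using hx i
      · have hlt : |⟪u i, x⟫| < 1 :=
          lt_of_le_of_ne (hx i) fun h => hi (by simp [hS, h])
        have h1 : ∀ᶠ δ : ℝ in nhds 0, |⟪u i, x + δ • (v : E)⟫| < 1 :=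
          (show Continuous fun δ : ℝ => |⟪u i, x + δ • (v : E)⟫| by
            fun_prop).continuousAt.eventually_lt
            continuousAt_const (by simpa using hlt)
        have h2 : ∀ᶠ δ : ℝ in nhds 0, |⟪u i, x - δ • (v : E)⟫| < 1 :=
          (show Continuous fun δ : ℝ => |⟪u i, x - δ • (v : E)⟫| by
            fun_prop).continuousAt.eventually_lt
            continuousAt_const (by simpa using hlt)
        filter_upwards [h1, h2] with δ a b using ⟨a.le, b.le⟩
    obtain ⟨δ, hδ, hδ0⟩ : ∃ δ : ℝ, (∀ i, |⟪u i, x + δ • (v : E)⟫| ≤ 1 ∧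
        |⟪u i, x - δ • (v : E)⟫| ≤ 1) ∧ 0 < δ :=
      (((Filter.eventually_all.2 hsmall).filter_mono nhdsWithin_le_nhds).and
        (self_mem_nhdsWithin (s := Set.Ioi (0 : ℝ)))).exists
    have := hext (δ • (v : E)) (W.smul_mem _ v.2) (fun i => (hδ i).1) (fun i => (hδ i).2)
    exact Subtype.ext ((smul_eq_zero.1 this).resolve_left hδ0.ne')
  have hcard : Module.finrank ℝ W ≤ S.card := by
    simpa using LinearMap.finrank_le_finrank_of_injective hL
  calc (Module.finrank ℝ W : ℝ) ≤ S.card := by exact_mod_cast hcard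
    _ = ∑ i ∈ S, ⟪u i, x⟫ ^ 2 := by
      rw [Finset.card_eq_sum_ones, Nat.cast_sum]
      refine Finset.sum_congr rfl fun i hi => ?_
      rw [← sq_abs, (Finset.mem_filter.1 hi).2]
      simp
    _ ≤ ∑ i, ⟪u i, x⟫ ^ 2 :=
      Finset.sum_le_sum_of_subset_of_nonneg (Finset.subset_univ _) fun _ _ _ => sq_nonneg _

/-- A continuous function that is midpoint convex on `W` does not decrease when one passes from a
point of the bounded polytope `{y ∈ W | ∀ i, |⟪u i, y⟫| ≤ 1}` to a suitable vertex. -/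
lemma exists_vertex_ge [FiniteDimensional ℝ E] (u : κ → E) (W : Submodule ℝ E) {R : ℝ}
    (hR : ∀ x, (∀ i, |⟪u i, x⟫| ≤ 1) → ‖x‖ ≤ R) {φ : E → ℝ} (hφ : Continuous φ)
    (hmid : ∀ x ∈ W, ∀ v ∈ W, 2 * φ x ≤ φ (x + v) + φ (x - v))
    {x₀ : E} (hx₀W : x₀ ∈ W) (hx₀ : ∀ i, |⟪u i, x₀⟫| ≤ 1) :
    ∃ x ∈ W, (∀ i, |⟪u i, x⟫| ≤ 1) ∧ φ x₀ ≤ φ x ∧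
      (Module.finrank ℝ W : ℝ) ≤ ∑ i, ⟪u i, x⟫ ^ 2 := by
  let K : Set E := {x | x ∈ W ∧ ∀ i, |⟪u i, x⟫| ≤ 1}
  have hKclosed : IsClosed K := by
    have h2 : IsClosed {x : E | ∀ i, |⟪u i, x⟫| ≤ 1} := by
      simp only [Set.ofPred_forall]
      exact isClosed_iInter fun i => isClosed_le (by fun_prop) continuous_const
    exact W.closed_of_finiteDimensional.inter h2
  have hK : IsCompact K :=
    (isCompact_closedBall (0 : E) R).of_isClosed_subset hKclosed fun x hx => by
      simpa using hR x hx.2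
  obtain ⟨m, hmK, hm⟩ := hK.exists_isMaxOn ⟨x₀, hx₀W, hx₀⟩ hφ.continuousOn
  have hM : IsCompact (K ∩ {x | φ x = φ m}) :=
    hK.inter_right (isClosed_eq hφ continuous_const)
  obtain ⟨x, ⟨hxK, hxm⟩, hx⟩ := hM.exists_isMaxOn ⟨m, hmK, rfl⟩ continuous_norm.continuousOn
  have hxm : φ x = φ m := hxm
  refine ⟨x, hxK.1, hxK.2, hxm ▸ hm ⟨hx₀W, hx₀⟩, ?_⟩
  refine finrank_le_sum_inner_sq_of_extreme u W hxK.2 fun v hv hp hn => ?_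
  have hpK : x + v ∈ K := ⟨W.add_mem hxK.1 hv, hp⟩
  have hnK : x - v ∈ K := ⟨W.sub_mem hxK.1 hv, hn⟩
  have h1 : φ (x + v) ≤ φ m := hm hpK
  have h2 : φ (x - v) ≤ φ m := hm hnK
  have h3 := hmid x hxK.1 v hv
  have h4 : ‖x + v‖ ≤ ‖x‖ := hx ⟨hpK, show φ (x + v) = φ m by linarith⟩
  have h5 : ‖x - v‖ ≤ ‖x‖ := hx ⟨hnK, show φ (x - v) = φ m by linarith⟩
  have h6 := parallelogram_law_with_norm ℝ x v
  have h7 : ‖v‖ = 0 := by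
    nlinarith [norm_nonneg v, norm_nonneg (x + v), norm_nonneg (x - v)]
  simpa using h7

/-- If the frame operator of `u` is diagonal in the orthonormal basis `b` with positive eigenvalues
`s`, then the polytope `{y | ∀ i, |⟪u i, y⟫| ≤ 1}` has a point of squared norm at least
`∑ l, 1 / s l`. -/
lemma exists_sum_inv_le_norm_sq {ι : Type*} [Fintype ι] (u : κ → E) {R : ℝ}
    (hR : ∀ x, (∀ i, |⟪u i, x⟫| ≤ 1) → ‖x‖ ≤ R)
    (b : OrthonormalBasis ι ℝ E) {s : ι → ℝ} (hs : ∀ l, 0 < s l)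
    (hdiag : ∀ x, ∑ i, ⟪u i, x⟫ ^ 2 = ∑ l, s l * ⟪b l, x⟫ ^ 2) :
    ∃ x, (∀ i, |⟪u i, x⟫| ≤ 1) ∧ ∑ l, (s l)⁻¹ ≤ ‖x‖ ^ 2 := by
  classical
  have : FiniteDimensional ℝ E := b.toBasis.finiteDimensional_of_finite
  have hspan : ∀ (J : Finset ι) (x : E), x ∈ Submodule.span ℝ (b '' J) → ∀ l ∉ J,
      ⟪b l, x⟫ = 0 := by
    intro J x hx l hl
    induction hx using Submodule.span_induction with
    | mem y hy =>
      obtain ⟨k, hk, rfl⟩ := hy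
      exact b.orthonormal.2 fun h => hl (h ▸ hk)
    | zero => simp
    | add y z _ _ hy hz => simp [inner_add_right, hy, hz]
    | smul c y _ hy => simp [inner_smul_right, hy]
  have hrank : ∀ J : Finset ι, Module.finrank ℝ (Submodule.span ℝ (b '' (J : Set ι))) = J.card := by
    intro J
    have hli : LinearIndependent ℝ (fun l : J => b l) :=
      b.orthonormal.linearIndependent.comp _ Subtype.val_injective
    have := finrank_span_eq_card hli
    rw [show Set.range (fun l : J => b l) = b '' (J : Set ι) by ext; simp] at this
    simpa using this
  have key : ∀ J : Finset ι, ∃ x ∈ Submodule.span ℝ (b '' (J : Set ι)), (∀ i, |⟪u i, x⟫| ≤ 1) ∧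
      ∀ t, 0 ≤ t → (∀ l ∈ J, t ≤ (s l)⁻¹) →
        ∑ l ∈ J, (s l)⁻¹ + t * (∑ i, ⟪u i, x⟫ ^ 2 - J.card) ≤ ‖x‖ ^ 2 := by
    intro J
    induction J using Finset.induction_on_max_value s with
    | empty => exact ⟨0, by simp, by simp, by simp⟩
    | insert a J haJ hmax ih =>
      obtain ⟨x₀, hx₀W, hx₀, hb⟩ := ih
      let φ : E → ℝ := fun x => ‖x‖ ^ 2 - (s a)⁻¹ * ∑ i, ⟪u i, x⟫ ^ 2
      set W := Submodule.span ℝ (b '' ((insert a J : Finset ι) : Set ι)) with hW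
      have hφpos : ∀ v ∈ W, 0 ≤ φ v := by
        intro v hv
        have : φ v = ∑ l, (1 - (s a)⁻¹ * s l) * ⟪b l, v⟫ ^ 2 := by
          simp only [φ, hdiag, ← b.sum_sq_inner_right v, Finset.mul_sum, ← Finset.sum_sub_distrib]
          refine Finset.sum_congr rfl fun l _ => ?_
          ring
        rw [this]
        refine Finset.sum_nonneg fun l _ => ?_
        by_cases hl : l ∈ insert a J
        · have hle : s l ≤ s a := by
            rcases Finset.mem_insert.1 hl with rfl | h
            exacts [le_rfl, hmax l h]
          have : (s a)⁻¹ * s l ≤ 1 := by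
            rw [inv_mul_le_iff₀ (hs a)]; simpa using hle
          exact mul_nonneg (by linarith) (sq_nonneg _)
        · simp [hspan _ v hv l hl]
      have hmid : ∀ x ∈ W, ∀ v ∈ W, 2 * φ x ≤ φ (x + v) + φ (x - v) := by
        intro x _ v hv
        have h1 := parallelogram_law_with_norm ℝ x v
        have h2 : ∑ i, ⟪u i, x + v⟫ ^ 2 + ∑ i, ⟪u i, x - v⟫ ^ 2 =
            2 * ∑ i, ⟪u i, x⟫ ^ 2 + 2 * ∑ i, ⟪u i, v⟫ ^ 2 := by
          simp only [Finset.mul_sum, ← Finset.sum_add_distrib, inner_add_right, inner_sub_right]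
          refine Finset.sum_congr rfl fun l _ => ?_
          ring
        have h3 := hφpos v hv
        simp only [φ] at h3 ⊢
        linear_combination 2 * h3 - h1 + (s a)⁻¹ * h2
      obtain ⟨x, hxW, hx, hφx, hq⟩ := exists_vertex_ge u W hR (φ := φ) (by fun_prop) hmid
        (Submodule.span_mono (Set.image_mono (by simp)) hx₀W) hx₀
      refine ⟨x, hxW, hx, fun t _ ht => ?_⟩
      rw [hW, hrank] at hq
      have h1 := hb (s a)⁻¹ (inv_nonneg.2 (hs a).le) fun l hl =>
        inv_anti₀ (hs l) (hmax l hl)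
      have h2 := mul_le_mul_of_nonneg_right (ht a (Finset.mem_insert_self _ _)) (sub_nonneg.2 hq)
      rw [Finset.card_insert_of_notMem haJ] at h2 ⊢
      rw [Finset.sum_insert haJ]
      simp only [φ] at hφx
      push_cast at h2 ⊢
      linarith
  obtain ⟨x, -, hx, hb⟩ := key Finset.univ
  exact ⟨x, hx, by simpa using hb 0 le_rfl fun l _ => inv_nonneg.2 (hs l).le⟩

/-- The frame operator `∑ i, u i ⊗ u i` is diagonalised by an orthonormal basis. -/
lemma exists_orthonormalBasis_sum_inner_sq [FiniteDimensional ℝ E] {d : ℕ}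
    (hd : Module.finrank ℝ E = d) (u : κ → E) :
    ∃ b : OrthonormalBasis (Fin d) ℝ E, ∀ x,
      ∑ i, ⟪u i, x⟫ ^ 2 = ∑ l, (∑ i, ⟪u i, b l⟫ ^ 2) * ⟪b l, x⟫ ^ 2 := by
  let T : E →ₗ[ℝ] E := ∑ i, (innerₛₗ ℝ (u i)).smulRight (u i)
  have hTapp : ∀ x y, ⟪x, T y⟫ = ∑ i, ⟪u i, x⟫ * ⟪u i, y⟫ := by
    intro x y
    simp only [T, LinearMap.sum_apply, inner_sum, LinearMap.smulRight_apply, inner_smul_right]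
    refine Finset.sum_congr rfl fun i _ => ?_
    rw [real_inner_comm x (u i), mul_comm]
    rfl
  have hT : T.IsSymmetric := by
    intro x y
    rw [real_inner_comm, hTapp, hTapp]
    exact Finset.sum_congr rfl fun i _ => mul_comm _ _
  refine ⟨hT.eigenvectorBasis hd, fun x => ?_⟩
  set b := hT.eigenvectorBasis hd
  have heig : ∀ l, T (b l) = hT.eigenvalues hd l • b l := fun l =>
    hT.apply_eigenvectorBasis hd l
  have hval : ∀ l, ∑ i, ⟪u i, b l⟫ ^ 2 = hT.eigenvalues hd l := by
    intro l
    simp only [sq]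
    rw [← hTapp, heig, inner_smul_right, real_inner_self_eq_norm_sq, b.norm_eq_one]
    simp
  calc ∑ i, ⟪u i, x⟫ ^ 2 = ⟪x, T x⟫ := by simp only [hTapp, sq]
    _ = ∑ l, ⟪x, b l⟫ * ⟪b l, T x⟫ := (b.sum_inner_mul_inner x (T x)).symm
    _ = _ := by
      refine Finset.sum_congr rfl fun l _ => ?_
      rw [hval, ← hT (b l) x, heig, real_inner_smul_left, real_inner_comm]
      ring

end Polytope

theorem qst_upper_bound (d n : ℕ) (u : Fin n → EuclideanSpace ℝ (Fin d))
    (hu : ∀ i, ‖u i‖ = 1) (ε : ℝ) (hε : 0 < ε) :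
    ¬ Metric.closedBall (0 : EuclideanSpace ℝ (Fin d)) (Real.sqrt n / d + ε) ⊆
        convexHull ℝ (Set.range u ∪ Set.range (fun i => -u i)) := by
  intro h
  have hr : 0 < Real.sqrt n / d + ε := by positivity
  rcases Nat.eq_zero_or_pos n with rfl | hn
  · simpa using h (Metric.mem_closedBall_self hr.le)
  have hd : 0 < d := by
    rcases Nat.eq_zero_or_pos d with rfl | hd
    · have := hu ⟨0, hn⟩
      rw [Subsingleton.elim (u ⟨0, hn⟩) 0] at this
      simp at this
    · exact hd
  obtain ⟨b, hb⟩ := exists_orthonormalBasis_sum_inner_sq finrank_euclideanSpace_fin u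
  set s : Fin d → ℝ := fun l => ∑ i, ⟪u i, b l⟫ ^ 2 with hs
  have hspos : ∀ l, 0 < s l := by
    intro l
    refine (Finset.sum_nonneg fun i _ => sq_nonneg _).lt_of_ne' fun h0 => ?_
    have hz : ∀ i, |⟪u i, b l⟫| ≤ 0 := fun i => by
      simpa using (Finset.sum_eq_zero_iff_of_nonneg fun i _ => sq_nonneg _).1 h0 i
    have := mul_norm_le_of_closedBall_subset u hr.le h hz
    rw [b.norm_eq_one] at this
    linarith
  have hsum : ∑ l, s l = n := by
    simp only [hs]
    rw [Finset.sum_comm]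
    simp [b.sum_sq_inner_left, hu]
  obtain ⟨x, hx, hxn⟩ := exists_sum_inv_le_norm_sq u (R := (Real.sqrt n / d + ε)⁻¹)
    (fun x hx => by
      rw [← one_div, le_div_iff₀' hr]
      exact mul_norm_le_of_closedBall_subset u hr.le h hx) b hspos hb
  have hle := mul_norm_le_of_closedBall_subset u hr.le h hx
  have hcs : (d : ℝ) ^ 2 ≤ (∑ l, (s l)⁻¹) * ∑ l, s l := by
    have := Finset.sum_sq_le_sum_mul_sum_of_sq_le_mul Finset.univ (r := fun _ => (1 : ℝ))
      (f := fun l => (s l)⁻¹) (g := s) (fun l _ => (inv_pos.2 (hspos l)).le)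
      (fun l _ => (hspos l).le) (fun l _ => by simp [(hspos l).ne'])
    simpa using this
  have hd' : (0 : ℝ) < d := by exact_mod_cast hd
  have hn' : (0 : ℝ) < n := by exact_mod_cast hn
  have hdx : (d : ℝ) ≤ Real.sqrt n * ‖x‖ := by
    refine (sq_le_sq₀ hd'.le (by positivity)).1 ?_
    rw [mul_pow, Real.sq_sqrt hn'.le]
    calc (d : ℝ) ^ 2 ≤ (∑ l, (s l)⁻¹) * n := hsum ▸ hcs
      _ ≤ ‖x‖ ^ 2 * n := by gcongr
      _ = n * ‖x‖ ^ 2 := mul_comm _ _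
  have hxpos : 0 < ‖x‖ := by
    by_contra h0
    nlinarith [Real.sqrt_nonneg (n : ℝ)]
  have h1 : 1 ≤ Real.sqrt n / d * ‖x‖ := by
    rw [div_mul_eq_mul_div, le_div_iff₀ hd']
    linarith
  nlinarith [mul_pos hε hxpos]
end

section
/- Let u_1, …, u_n be unit vectors spanning ℝ^d. Then the polar of the convex hull of {±u_1, …, ±u_n} contains a point of Euclidean norm at least d/√n. -/
def polarSet {d : ℕ} (S : Set (EuclideanSpace ℝ (Fin d))) : Set (EuclideanSpace ℝ (Fin d)) :=
  {x | ∀ s ∈ S, @inner ℝ _ _ x s ≤ 1}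

/-- A point of the cube `[-1, 1]^ι` moving along a nonzero direction reaches the boundary through a
coordinate along which it moves. -/
lemma exists_nonneg_hits_cube_boundary {ι : Type*} [Fintype ι] (a w : ι → ℝ)
    (ha : ∀ i, |a i| ≤ 1) (hw : ∃ i, w i ≠ 0) :
    ∃ t : ℝ, 0 ≤ t ∧ (∀ i, |a i + t * w i| ≤ 1) ∧ ∃ i, w i ≠ 0 ∧ |a i + t * w i| = 1 := by
  classical
  let τ : ι → ℝ := fun i => if 0 < w i then (1 - a i) / w i else (-1 - a i) / w i
  have hτ : ∀ i, w i ≠ 0 → 0 ≤ τ i ∧ |a i + τ i * w i| = 1 ∧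
      ∀ t, 0 ≤ t → t ≤ τ i → |a i + t * w i| ≤ 1 := by
    intro i hi
    have h := abs_le.mp (ha i)
    by_cases hpos : 0 < w i
    · have hval : τ i = (1 - a i) / w i := if_pos hpos
      have hmul : τ i * w i = 1 - a i := by rw [hval]; field_simp
      refine ⟨by rw [hval]; exact div_nonneg (by linarith) hpos.le, by rw [hmul]; simp, ?_⟩
      intro t ht htτ
      have h1 := mul_le_mul_of_nonneg_right htτ hpos.le
      have h2 := mul_nonneg ht hpos.le
      exact abs_le.mpr ⟨by linarith, by linarith⟩
    · have hneg : w i < 0 := lt_of_le_of_ne (not_lt.mp hpos) hi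
      have hval : τ i = (-1 - a i) / w i := if_neg hpos
      have hmul : τ i * w i = -1 - a i := by rw [hval]; field_simp
      refine ⟨by rw [hval]; exact div_nonneg_of_nonpos (by linarith) hneg.le,
        by rw [hmul]; simp, ?_⟩
      intro t ht htτ
      have h1 := mul_le_mul_of_nonpos_right htτ hneg.le
      have h2 := mul_nonpos_of_nonneg_of_nonpos ht hneg.le
      exact abs_le.mpr ⟨by linarith, by linarith⟩
  obtain ⟨i₀, hi₀⟩ := hw
  obtain ⟨i, hi, hmin⟩ := Finset.exists_min_image (Finset.univ.filter fun i => w i ≠ 0) τ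
    ⟨i₀, by simpa using hi₀⟩
  have hi' : w i ≠ 0 := by simpa using hi
  refine ⟨τ i, (hτ i hi').1, fun k => ?_, i, hi', (hτ i hi').2.1⟩
  by_cases hk : w k = 0
  · simpa [hk] using ha k
  · exact (hτ k hk).2.2 _ (hτ i hi').1 (hmin k (by simpa using hk))

section Frame

variable {E ι : Type*} [NormedAddCommGroup E] [InnerProductSpace ℝ E]

lemma exists_inner_ne_zero_of_span_eq_top {u : ι → E}
    (hspan : Submodule.span ℝ (Set.range u) = ⊤) {v : E} (hv : v ≠ 0) :
    ∃ i, inner ℝ v (u i) ≠ 0 := by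
  by_contra! h
  refine hv (inner_self_eq_zero (𝕜 := ℝ).mp ?_)
  have hle : Submodule.span ℝ (Set.range u) ≤ LinearMap.ker (innerₛₗ ℝ v) := by
    rw [Submodule.span_le]
    rintro _ ⟨i, rfl⟩
    simpa using h i
  have hmem : v ∈ LinearMap.ker (innerₛₗ ℝ v) := hle (hspan ▸ Submodule.mem_top)
  simpa using hmem

variable [Fintype ι]

/-- The coordinates in which a point of the symmetric polytope `{x | ∀ i, |⟪x, u i⟫| ≤ 1}` is
extremal. -/
noncomputable def activeConstraints (u : ι → E) (x : E) : Finset ι :=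
  Finset.univ.filter fun i => |inner ℝ x (u i)| = 1

lemma card_activeConstraints_le (u : ι → E) (x : E) :
    ((activeConstraints u x).card : ℝ) ≤ ∑ i, inner ℝ x (u i) ^ 2 := by
  calc ((activeConstraints u x).card : ℝ)
      = ∑ i ∈ activeConstraints u x, inner ℝ x (u i) ^ 2 := by
        rw [Finset.card_eq_sum_ones, Nat.cast_sum]
        refine Finset.sum_congr rfl fun i hi => ?_
        have h : |inner ℝ x (u i)| = 1 := by simpa [activeConstraints] using hi
        rw [← sq_abs, h]; simp
    _ ≤ _ := Finset.sum_le_sum_of_subset_of_nonneg (Finset.subset_univ _)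
        fun i _ _ => sq_nonneg _

variable {d : ℕ} (b : OrthonormalBasis (Fin d) ℝ E)

/-- If `x` has at most `j` active constraints, some nonzero direction in the span of the first
`j + 1` basis vectors keeps all of them active. -/
lemma exists_direction_preserving_active (u : ι → E) (x : E) (j : Fin d)
    (hcard : (activeConstraints u x).card ≤ j) :
    ∃ v : E, v ≠ 0 ∧ (∀ k, j < k → inner ℝ (b k) v = 0) ∧
      ∀ i, |inner ℝ x (u i)| = 1 → inner ℝ v (u i) = 0 := by
  classical
  have : FiniteDimensional ℝ E := b.toBasis.finiteDimensional_of_finite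
  let w : (activeConstraints u x) ⊕ (Finset.Ioi j) → E := Sum.elim (fun i => u i) (fun k => b k)
  let Φ : E →ₗ[ℝ] ((activeConstraints u x) ⊕ (Finset.Ioi j) → ℝ) :=
    LinearMap.pi fun s => innerₛₗ ℝ (w s)
  have hker : LinearMap.ker Φ ≠ ⊥ := by
    apply LinearMap.ker_ne_bot_of_finrank_lt
    rw [Module.finrank_fintype_fun_eq_card, Module.finrank_eq_card_basis b.toBasis]
    simp only [Fintype.card_sum, Fintype.card_coe, Fin.card_Ioi, Fintype.card_fin]
    have := j.isLt
    omega
  obtain ⟨v, hv, hv0⟩ := Submodule.exists_mem_ne_zero_of_ne_bot hker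
  have hw : ∀ s, inner ℝ (w s) v = 0 := fun s => congrFun (LinearMap.mem_ker.mp hv) s
  refine ⟨v, hv0, fun k hk => hw (Sum.inr ⟨k, Finset.mem_Ioi.mpr hk⟩), fun i hi => ?_⟩
  rw [real_inner_comm]
  exact hw (Sum.inl ⟨i, by simpa [activeConstraints] using hi⟩)

/-- A point can be moved within the span of the first `j + 1` basis vectors so as to gain an active
constraint, without decreasing a quadratic form that is nonnegative on that span. -/
lemma exists_more_active (u : ι → E) (hspan : Submodule.span ℝ (Set.range u) = ⊤)
    (c : Fin d → ℝ) (j : Fin d) (hc : ∀ k ≤ j, 0 ≤ c k) (x : E)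
    (hx : ∀ i, |inner ℝ x (u i)| ≤ 1) (hxj : ∀ k, j < k → inner ℝ (b k) x = 0)
    (hcard : (j : ℕ) ≤ (activeConstraints u x).card) :
    ∃ y : E, (∀ i, |inner ℝ y (u i)| ≤ 1) ∧ (∀ k, j < k → inner ℝ (b k) y = 0) ∧
      (j : ℕ) + 1 ≤ (activeConstraints u y).card ∧
      ∑ k, c k * inner ℝ (b k) x ^ 2 ≤ ∑ k, c k * inner ℝ (b k) y ^ 2 := by
  classical
  rcases hcard.lt_or_eq with hlt | heq
  · exact ⟨x, hx, hxj, hlt, le_rfl⟩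
  obtain ⟨v, hv0, hvj, hva, hcross⟩ : ∃ v : E, v ≠ 0 ∧ (∀ k, j < k → inner ℝ (b k) v = 0) ∧
      (∀ i, |inner ℝ x (u i)| = 1 → inner ℝ v (u i) = 0) ∧
      0 ≤ ∑ k, c k * (inner ℝ (b k) x * inner ℝ (b k) v) := by
    obtain ⟨v, hv0, hvj, hva⟩ := exists_direction_preserving_active b u x j heq.ge
    rcases le_total 0 (∑ k, c k * (inner ℝ (b k) x * inner ℝ (b k) v)) with h | h
    · exact ⟨v, hv0, hvj, hva, h⟩
    · refine ⟨-v, neg_ne_zero.mpr hv0, fun k hk => by simp [hvj k hk],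
        fun i hi => by simp [hva i hi], ?_⟩
      simpa [inner_neg_right, Finset.sum_neg_distrib] using h
  obtain ⟨t, ht, hle, i, hi, hti⟩ := exists_nonneg_hits_cube_boundary
    (fun i => inner ℝ x (u i)) (fun i => inner ℝ v (u i)) hx
    (exists_inner_ne_zero_of_span_eq_top hspan hv0)
  have hy : ∀ i, inner ℝ (x + t • v) (u i) = inner ℝ x (u i) + t * inner ℝ v (u i) := fun i => by
    rw [inner_add_left, real_inner_smul_left]
  refine ⟨x + t • v, fun i => by rw [hy]; exact hle i, fun k hk => ?_, ?_, ?_⟩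
  · rw [inner_add_right, real_inner_smul_right, hxj k hk, hvj k hk]; simp
  · have hi_not : i ∉ activeConstraints u x := fun h =>
      hi (hva i (by simpa [activeConstraints] using h))
    rw [heq, ← Finset.card_insert_of_notMem hi_not]
    refine Finset.card_le_card (Finset.insert_subset ?_ fun k hk => ?_)
    · simpa [activeConstraints, hy] using hti
    · have hk' : |inner ℝ x (u k)| = 1 := by simpa [activeConstraints] using hk
      simpa [activeConstraints, hy, hva k hk'] using hk'
  · have hexpand : ∑ k, c k * inner ℝ (b k) (x + t • v) ^ 2 =
        ∑ k, c k * inner ℝ (b k) x ^ 2 +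
          2 * t * ∑ k, c k * (inner ℝ (b k) x * inner ℝ (b k) v) +
          t ^ 2 * ∑ k, c k * inner ℝ (b k) v ^ 2 := by
      simp only [Finset.mul_sum, ← Finset.sum_add_distrib]
      refine Finset.sum_congr rfl fun k _ => ?_
      rw [inner_add_right, real_inner_smul_right]
      ring
    have hquad : 0 ≤ ∑ k, c k * inner ℝ (b k) v ^ 2 := by
      refine Finset.sum_nonneg fun k _ => ?_
      rcases le_or_gt k j with hk | hk
      · exact mul_nonneg (hc k hk) (sq_nonneg _)
      · simp [hvj k hk]
    rw [hexpand]
    have h1 := mul_nonneg (mul_nonneg zero_le_two ht) hcross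
    have h2 := mul_nonneg (sq_nonneg t) hquad
    linarith

/-- Stage `j` of the construction: a point in the span of the first `j` basis vectors, with at least
`j` active constraints, whose norm is controlled by the reciprocals of the first `j` eigenvalues. -/
lemma exists_stage (u : ι → E) (hspan : Submodule.span ℝ (Set.range u) = ⊤)
    (μ : Fin d → ℝ) (hμ : Monotone μ) (hpos : ∀ k, 0 < μ k)
    (hdiag : ∀ x, ∑ i, inner ℝ x (u i) ^ 2 = ∑ k, μ k * inner ℝ (b k) x ^ 2)
    (j : ℕ) (hj : j ≤ d) :
    ∃ x : E, (∀ i, |inner ℝ x (u i)| ≤ 1) ∧ (∀ k : Fin d, j ≤ k → inner ℝ (b k) x = 0) ∧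
      j ≤ (activeConstraints u x).card ∧
      ∀ a : ℝ, (∀ k : Fin d, (k : ℕ) < j → a ≤ (μ k)⁻¹) →
        ∑ k ∈ Finset.univ.filter (fun k : Fin d => (k : ℕ) < j), (μ k)⁻¹ ≤
          ‖x‖ ^ 2 + a * (j - ∑ i, inner ℝ x (u i) ^ 2) := by
  classical
  induction j with
  | zero => exact ⟨0, by simp, by simp, by simp, by simp⟩
  | succ j ih =>
    obtain ⟨x, hx, hxj, hcard, hbound⟩ := ih (by omega)
    let m : Fin d := ⟨j, hj⟩
    have hnorm : ∀ z : E, ∑ k, (1 - (μ m)⁻¹ * μ k) * inner ℝ (b k) z ^ 2 =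
        ‖z‖ ^ 2 - (μ m)⁻¹ * ∑ i, inner ℝ z (u i) ^ 2 := fun z => by
      rw [hdiag, ← b.sum_sq_norm_inner_right z, Finset.mul_sum, ← Finset.sum_sub_distrib]
      refine Finset.sum_congr rfl fun k _ => ?_
      rw [Real.norm_eq_abs, sq_abs]
      ring
    obtain ⟨y, hy, hyj, hycard, hxy⟩ := exists_more_active b u hspan
      (fun k => 1 - (μ m)⁻¹ * μ k) m
      (fun k hk => sub_nonneg.mpr (by
        rw [inv_mul_le_iff₀ (hpos m), mul_one]; exact hμ hk)) x hx
      (fun k hk => hxj k (Fin.lt_def.mp hk).le) hcard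
    rw [hnorm, hnorm] at hxy
    refine ⟨y, hy, fun k hk => hyj k (Fin.lt_def.mpr hk), hycard, fun a ha => ?_⟩
    have hsum : ∑ k ∈ Finset.univ.filter (fun k : Fin d => (k : ℕ) < j + 1), (μ k)⁻¹ =
        (μ m)⁻¹ + ∑ k ∈ Finset.univ.filter (fun k : Fin d => (k : ℕ) < j), (μ k)⁻¹ := by
      have hset : Finset.univ.filter (fun k : Fin d => (k : ℕ) < j + 1) =
          insert m (Finset.univ.filter fun k : Fin d => (k : ℕ) < j) := by
        ext k
        simp only [Finset.mem_filter, Finset.mem_univ, true_and, Finset.mem_insert, Fin.ext_iff, m]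
        omega
      rw [hset, Finset.sum_insert (by simp [m])]
    have hprev := hbound (μ m)⁻¹
      fun k hk => inv_anti₀ (hpos k) (hμ (Fin.le_def.mpr hk.le))
    have hN : ((j : ℝ) + 1) ≤ ∑ i, inner ℝ y (u i) ^ 2 :=
      le_trans (by exact_mod_cast hycard) (card_activeConstraints_le u y)
    have ham : a ≤ (μ m)⁻¹ := ha m (Nat.lt_succ_self j)
    have := mul_nonneg (sub_nonneg.mpr ham) (sub_nonneg.mpr hN)
    rw [hsum]
    push_cast
    linarith

/-- The frame operator `∑ i, u i ⊗ u i` is diagonal in some orthonormal basis, with increasing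
eigenvalues. -/
lemma exists_orthonormalBasis_diagonalizing_frame [FiniteDimensional ℝ E]
    (hd : Module.finrank ℝ E = d) (u : ι → E) :
    ∃ (b : OrthonormalBasis (Fin d) ℝ E) (μ : Fin d → ℝ), Monotone μ ∧
      ∀ x, ∑ i, inner ℝ x (u i) ^ 2 = ∑ k, μ k * inner ℝ (b k) x ^ 2 := by
  let T : E →ₗ[ℝ] E := ∑ i, (innerₛₗ ℝ (u i)).smulRight (u i)
  have hT : ∀ x, T x = ∑ i, inner ℝ (u i) x • u i := fun x => by
    simp [T, LinearMap.sum_apply]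
  have hsymm : T.IsSymmetric := fun x y => by
    rw [hT, hT, sum_inner, inner_sum]
    refine Finset.sum_congr rfl fun i _ => ?_
    rw [real_inner_smul_left, real_inner_smul_right, real_inner_comm x (u i)]
    ring
  let σ := Tuple.sort (hsymm.eigenvalues hd)
  refine ⟨(hsymm.eigenvectorBasis hd).reindex σ.symm, hsymm.eigenvalues hd ∘ σ,
    Tuple.monotone_sort _, fun x => ?_⟩
  have hsum : ∑ k, (hsymm.eigenvalues hd ∘ σ) k *
      inner ℝ ((hsymm.eigenvectorBasis hd).reindex σ.symm k) x ^ 2 =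
      ∑ k, hsymm.eigenvalues hd k * inner ℝ (hsymm.eigenvectorBasis hd k) x ^ 2 := by
    simpa using Equiv.sum_comp σ
      fun k => hsymm.eigenvalues hd k * inner ℝ (hsymm.eigenvectorBasis hd k) x ^ 2
  rw [hsum]
  calc ∑ i, inner ℝ x (u i) ^ 2 = inner ℝ x (T x) := by
        rw [hT, inner_sum]
        refine Finset.sum_congr rfl fun i _ => ?_
        rw [real_inner_smul_right, real_inner_comm]
        ring
    _ = _ := by
        rw [← (hsymm.eigenvectorBasis hd).sum_inner_mul_inner x (T x)]
        refine Finset.sum_congr rfl fun k _ => ?_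
        rw [← hsymm, hsymm.apply_eigenvectorBasis]
        simp only [RCLike.ofReal_real_eq_id, id_eq, real_inner_smul_left,
          real_inner_comm (hsymm.eigenvectorBasis hd k) x]
        ring

end Frame

lemma mem_polarSet_convexHull_of_abs_inner_le {d : ℕ} {ι : Type*}
    {u : ι → EuclideanSpace ℝ (Fin d)} {q : EuclideanSpace ℝ (Fin d)}
    (hq : ∀ i, |inner ℝ q (u i)| ≤ 1) :
    q ∈ polarSet (convexHull ℝ (Set.range u ∪ Set.range (fun i => -u i))) := by
  have hconv : Convex ℝ {s | innerₛₗ ℝ q s ≤ 1} :=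
    convex_halfSpace_le (innerₛₗ ℝ q).isLinear 1
  refine fun s hs => convexHull_min ?_ hconv hs
  rintro _ (⟨i, rfl⟩ | ⟨i, rfl⟩)
  · simpa using (abs_le.mp (hq i)).2
  · simpa using neg_le.mp (abs_le.mp (hq i)).1

theorem polar_contains_long_point (d n : ℕ) (u : Fin n → EuclideanSpace ℝ (Fin d))
    (hu : ∀ i, ‖u i‖ = 1)
    (hspan : Submodule.span ℝ (Set.range u) = ⊤) :
    ∃ q ∈ polarSet (convexHull ℝ (Set.range u ∪ Set.range (fun i => -u i))),
      (d : ℝ) / Real.sqrt n ≤ ‖q‖ := by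
  obtain ⟨b, μ, hμ, hdiag⟩ :=
    exists_orthonormalBasis_diagonalizing_frame (d := d) (by simp) u
  have heig : ∀ k, μ k = ∑ i, inner ℝ (b k) (u i) ^ 2 := fun k => by
    rw [hdiag, Finset.sum_eq_single k]
    · simp
    · intro l _ hl
      simp [b.orthonormal.2 hl]
    · simp
  have hpos : ∀ k, 0 < μ k := fun k => by
    obtain ⟨i, hi⟩ := exists_inner_ne_zero_of_span_eq_top hspan (b.orthonormal.ne_zero k)
    rw [heig]
    exact Finset.sum_pos' (fun _ _ => sq_nonneg _) ⟨i, Finset.mem_univ i, by positivity⟩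
  have htrace : ∑ k, μ k = n := by
    have hparseval : ∀ i, ∑ k, inner ℝ (b k) (u i) ^ 2 = 1 := fun i => by
      simpa [hu] using b.sum_sq_norm_inner_right (u i)
    simp_rw [heig]
    rw [Finset.sum_comm]
    simp [hparseval]
  obtain ⟨q, hq, -, -, hbound⟩ := exists_stage b u hspan μ hμ hpos hdiag d le_rfl
  refine ⟨q, mem_polarSet_convexHull_of_abs_inner_le hq, ?_⟩
  have hinv : ∑ k, (μ k)⁻¹ ≤ ‖q‖ ^ 2 := by
    simpa using hbound 0 fun k _ => inv_nonneg.mpr (hpos k).le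
  have hcs := Finset.sq_sum_div_le_sum_sq_div Finset.univ (fun _ => (1 : ℝ))
    fun k _ => hpos k
  refine le_of_sq_le_sq ?_ (norm_nonneg q)
  rw [div_pow, Real.sq_sqrt n.cast_nonneg]
  refine le_trans ?_ hinv
  simpa [htrace] using hcs
end

section
/- Let v_1, …, v_n ∈ ℝ^d satisfy ∑_{i=1}^n v_i ⊗ v_i = Id (i.e., they form a tight frame with ∑ ⟨v_i,x⟩ v_i = x for all x). Then for every positive semi-definite linear operator T on ℝ^d there exists a point p with |⟨p, v_i⟩| ≤ 1 for all i and ⟨p, T p⟩ ≥ tr T. -/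
open scoped InnerProductSpace

section TightFrame

variable {ι E : Type*} [Fintype ι] [NormedAddCommGroup E] [InnerProductSpace ℝ E]

/-- A family `v` is a tight frame when `∑ i, v i ⊗ v i` is the identity. -/
def IsTightFrame (v : ι → E) : Prop := ∀ x, ∑ i, ⟪v i, x⟫_ℝ • v i = x

/-- The points `x` with `|⟪x, v i⟫| ≤ 1` for all `i`. -/
def slabs (v : ι → E) : Set E := {x | ∀ i, |⟪x, v i⟫_ℝ| ≤ 1}

namespace IsTightFrame

variable {v : ι → E}

theorem sum_inner_mul_inner (hv : IsTightFrame v) (x y : E) :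
    ∑ i, ⟪v i, x⟫_ℝ * ⟪v i, y⟫_ℝ = ⟪x, y⟫_ℝ := by
  conv_rhs => rw [← hv x]
  simp [sum_inner, real_inner_smul_left]

theorem sum_inner_sq (hv : IsTightFrame v) (x : E) : ∑ i, ⟪x, v i⟫_ℝ ^ 2 = ‖x‖ ^ 2 := by
  rw [← real_inner_self_eq_norm_sq, ← hv.sum_inner_mul_inner]
  exact Finset.sum_congr rfl fun i _ => by rw [real_inner_comm, sq]

theorem isCompact_slabs [FiniteDimensional ℝ E] (hv : IsTightFrame v) :
    IsCompact (slabs v) := by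
  refine Metric.isCompact_of_isClosed_isBounded ?_ ?_
  · simp only [slabs, Set.ofPred_forall]
    exact isClosed_iInter fun i => isClosed_le (by fun_prop) continuous_const
  · refine (Metric.isBounded_closedBall (x := (0 : E)) (r := Fintype.card ι + 1)).subset ?_
    intro x hx
    rw [mem_closedBall_zero_iff]
    have h : ‖x‖ ^ 2 ≤ Fintype.card ι := by
      rw [← hv.sum_inner_sq]
      calc ∑ i, ⟪x, v i⟫_ℝ ^ 2 ≤ ∑ _i : ι, (1 : ℝ) :=
            Finset.sum_le_sum fun i _ => (sq_le_one_iff_abs_le_one _).2 (hx i)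
        _ = Fintype.card ι := by simp
    nlinarith [norm_nonneg x]

theorem trace_eq_sum [FiniteDimensional ℝ E] (hv : IsTightFrame v) (T : E →ₗ[ℝ] E) :
    LinearMap.trace ℝ E T = ∑ i, ⟪v i, T (v i)⟫_ℝ := by
  let b := stdOrthonormalBasis ℝ E
  have h (j) : ⟪b j, T (b j)⟫_ℝ = ∑ i, ⟪v i, b j⟫_ℝ * ⟪b j, T (v i)⟫_ℝ := by
    conv_lhs => rw [← hv (b j), map_sum, hv (b j)]
    simp [inner_sum, real_inner_smul_right]
  rw [LinearMap.trace_eq_sum_inner T b]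
  simp_rw [h]
  rw [Finset.sum_comm]
  exact Finset.sum_congr rfl fun i _ => b.sum_inner_mul_inner _ _

theorem orthogonalProjectionOnto (hv : IsTightFrame v) (U : Submodule ℝ E)
    [U.HasOrthogonalProjection] : IsTightFrame fun i => U.orthogonalProjectionOnto (v i) := by
  intro x
  have h := congrArg U.orthogonalProjectionOnto (hv x)
  simpa [map_sum] using h

end IsTightFrame

/-- At a point of `slabs v` whose tight constraints do not span, there is a direction in which
one can move both ways. -/
theorem exists_add_sub_mem_slabs {v : ι → E} {p : E} (hp : p ∈ slabs v) {u : E}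
    (hu : ∀ i, |⟪p, v i⟫_ℝ| = 1 → ⟪u, v i⟫_ℝ = 0) :
    ∃ t : ℝ, 0 < t ∧ p + t • u ∈ slabs v ∧ p - t • u ∈ slabs v := by
  have h (i) : ∀ᶠ t : ℝ in nhdsWithin 0 (Set.Ioi 0),
      |⟪p + t • u, v i⟫_ℝ| ≤ 1 ∧ |⟪p - t • u, v i⟫_ℝ| ≤ 1 := by
    rcases (hp i).eq_or_lt with h1 | h1
    · simp [inner_add_left, inner_sub_left, real_inner_smul_left, hu i h1, h1]
    · refine Filter.Eventually.filter_mono nhdsWithin_le_nhds (Filter.Eventually.and ?_ ?_)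
      · have hc : ContinuousAt (fun t : ℝ => |⟪p + t • u, v i⟫_ℝ|) 0 := by fun_prop
        exact (hc.eventually_lt_const (by simpa using h1)).mono fun _ => le_of_lt
      · have hc : ContinuousAt (fun t : ℝ => |⟪p - t • u, v i⟫_ℝ|) 0 := by fun_prop
        exact (hc.eventually_lt_const (by simpa using h1)).mono fun _ => le_of_lt
  obtain ⟨t, ht, ht0⟩ := ((Filter.eventually_all.2 h).and self_mem_nhdsWithin).exists
  exact ⟨t, ht0, fun i => (ht i).1, fun i => (ht i).2⟩

theorem finrank_le_norm_sq [FiniteDimensional ℝ E] {v : ι → E} (hv : IsTightFrame v) {p : E}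
    (h : ∀ u, (∀ i, |⟪p, v i⟫_ℝ| = 1 → ⟪u, v i⟫_ℝ = 0) → u = 0) :
    (Module.finrank ℝ E : ℝ) ≤ ‖p‖ ^ 2 := by
  classical
  let s := Finset.univ.filter fun i => |⟪p, v i⟫_ℝ| = 1
  have hs : Submodule.span ℝ (s.image v : Set E) = ⊤ := by
    rw [← Submodule.orthogonal_eq_bot_iff, Submodule.eq_bot_iff]
    refine fun u hu => h u fun i hi => ?_
    rw [real_inner_comm]
    exact hu _ (Submodule.subset_span (by simpa [s] using ⟨i, hi, rfl⟩))
  have hcard : Module.finrank ℝ E ≤ s.card := by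
    rw [← finrank_top ℝ E, ← hs]
    exact (finrank_span_finset_le_card _).trans Finset.card_image_le
  calc (Module.finrank ℝ E : ℝ) ≤ s.card := mod_cast hcard
    _ = ∑ i ∈ s, ⟪p, v i⟫_ℝ ^ 2 := by
        rw [Finset.card_eq_sum_ones, Nat.cast_sum]
        refine Finset.sum_congr rfl fun i hi => ?_
        rw [← sq_abs, (Finset.mem_filter.1 hi).2]
        norm_num
    _ ≤ ∑ i, ⟪p, v i⟫_ℝ ^ 2 :=
        Finset.sum_le_sum_of_subset_of_nonneg (Finset.subset_univ _) fun _ _ _ => sq_nonneg _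
    _ = ‖p‖ ^ 2 := hv.sum_inner_sq p

/-- A positive semi-definite form on `slabs v` is maximised at a vertex, and vertices are long. -/
theorem exists_mem_slabs_isMaxOn [FiniteDimensional ℝ E] {v : ι → E} (hv : IsTightFrame v)
    {T : E →ₗ[ℝ] E} (hT : ∀ x, 0 ≤ ⟪x, T x⟫_ℝ) :
    ∃ p ∈ slabs v, IsMaxOn (fun x => ⟪x, T x⟫_ℝ) (slabs v) p ∧
      (Module.finrank ℝ E : ℝ) ≤ ‖p‖ ^ 2 := by
  have hcont : Continuous fun x => ⟪x, T x⟫_ℝ :=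
    continuous_id.inner T.continuous_of_finiteDimensional
  have hK := hv.isCompact_slabs
  obtain ⟨q, hq, hqmax⟩ := hK.exists_isMaxOn ⟨0, fun i => by simp⟩ hcont.continuousOn
  obtain ⟨p, ⟨hp, hpq⟩, hpmax⟩ :=
    (hK.inter_right (isClosed_le (continuous_const (y := ⟪q, T q⟫_ℝ)) hcont)).exists_isMaxOn
      ⟨q, hq, le_refl ⟪q, T q⟫_ℝ⟩ (f := fun x => ‖x‖ ^ 2) (by fun_prop)
  refine ⟨p, hp, fun x hx => le_trans (b := ⟪q, T q⟫_ℝ) (hqmax hx) hpq, finrank_le_norm_sq hv fun u hu => ?_⟩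
  obtain ⟨t, ht, hadd, hsub⟩ := exists_add_sub_mem_slabs hp hu
  have h₁ : ⟪p + t • u, T (p + t • u)⟫_ℝ ≤ ⟪q, T q⟫_ℝ := hqmax hadd
  have h₂ : ⟪p - t • u, T (p - t • u)⟫_ℝ ≤ ⟪q, T q⟫_ℝ := hqmax hsub
  have hsum : ⟪p + t • u, T (p + t • u)⟫_ℝ + ⟪p - t • u, T (p - t • u)⟫_ℝ =
      2 * ⟪p, T p⟫_ℝ + 2 * ⟪t • u, T (t • u)⟫_ℝ := by
    simp only [map_add, map_sub, inner_add_left, inner_add_right, inner_sub_left,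
      inner_sub_right]
    ring
  have hnn := hT (t • u)
  have hpq' : ⟪q, T q⟫_ℝ ≤ ⟪p, T p⟫_ℝ := hpq
  have hadd' : ⟪q, T q⟫_ℝ ≤ ⟪p + t • u, T (p + t • u)⟫_ℝ := by linarith
  have hsub' : ⟪q, T q⟫_ℝ ≤ ⟪p - t • u, T (p - t • u)⟫_ℝ := by linarith
  have h₃ : ‖p + t • u‖ ^ 2 ≤ ‖p‖ ^ 2 := hpmax ⟨hadd, hadd'⟩
  have h₄ : ‖p - t • u‖ ^ 2 ≤ ‖p‖ ^ 2 := hpmax ⟨hsub, hsub'⟩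
  have hpar := parallelogram_law_with_norm ℝ p (t • u)
  have hzero : ‖t • u‖ = 0 := by nlinarith [norm_nonneg (t • u)]
  exact (smul_eq_zero.1 (norm_eq_zero.1 hzero)).resolve_left ht.ne'

/-- Subtracting the least eigenvalue of a symmetric operator leaves a positive semi-definite
operator with a kernel. -/
theorem LinearMap.IsSymmetric.exists_least_eigenvector [FiniteDimensional ℝ E] [Nontrivial E]
    {T : E →ₗ[ℝ] E} (hT : T.IsSymmetric) :
    ∃ (c : ℝ) (w : E), w ≠ 0 ∧ T w = c • w ∧ ∀ x, c * ‖x‖ ^ 2 ≤ ⟪x, T x⟫_ℝ := by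
  let b := hT.eigenvectorBasis rfl
  have : NeZero (Module.finrank ℝ E) := ⟨Module.finrank_pos.ne'⟩
  obtain ⟨j, hj⟩ := Finite.exists_min (hT.eigenvalues rfl)
  refine ⟨hT.eigenvalues rfl j, b j, b.orthonormal.ne_zero j,
    hT.apply_eigenvectorBasis rfl j, fun x => ?_⟩
  have h (i) : ⟪b i, T x⟫_ℝ = hT.eigenvalues rfl i * ⟪b i, x⟫_ℝ := by
    rw [← hT, hT.apply_eigenvectorBasis rfl i, RCLike.ofReal_real_eq_id, id_eq,
      real_inner_smul_left]
  rw [← real_inner_self_eq_norm_sq, ← b.sum_inner_mul_inner, ← b.sum_inner_mul_inner,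
    Finset.mul_sum]
  refine Finset.sum_le_sum fun i _ => ?_
  rw [h, real_inner_comm (b i) x]
  nlinarith [hj i, mul_self_nonneg ⟪b i, x⟫_ℝ]

end TightFrame

theorem exists_mem_slabs_trace_le {ι : Type*} [Fintype ι] (d : ℕ) {E : Type*}
    [NormedAddCommGroup E] [InnerProductSpace ℝ E] [FiniteDimensional ℝ E]
    (hd : Module.finrank ℝ E = d) {v : ι → E} (hv : IsTightFrame v) {T : E →ₗ[ℝ] E}
    (hsym : T.IsSymmetric) (hpos : ∀ x, 0 ≤ ⟪x, T x⟫_ℝ) :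
    ∃ p ∈ slabs v, LinearMap.trace ℝ E T ≤ ⟪p, T p⟫_ℝ := by
  induction d using Nat.strong_induction_on generalizing E with
  | _ d ih =>
  rcases subsingleton_or_nontrivial E with _ | _
  · refine ⟨0, fun i => by simp, ?_⟩
    rw [hv.trace_eq_sum]
    simp [Subsingleton.elim _ (0 : E)]
  obtain ⟨c, w, hw, hTw, hc⟩ := hsym.exists_least_eigenvector
  have hc0 : 0 ≤ c := by
    have h := hpos w
    rw [hTw, real_inner_smul_right, real_inner_self_eq_norm_sq] at h
    have : 0 < ‖w‖ ^ 2 := by positivity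
    exact nonneg_of_mul_nonneg_left h this
  let S : E →ₗ[ℝ] E := T - c • LinearMap.id
  have hS (x : E) : S x = T x - c • x := rfl
  have hSinner (x : E) : ⟪x, S x⟫_ℝ = ⟪x, T x⟫_ℝ - c * ‖x‖ ^ 2 := by
    rw [hS, inner_sub_right, real_inner_smul_right, real_inner_self_eq_norm_sq]
  have hSsym : S.IsSymmetric := fun x y => by
    rw [hS, hS, inner_sub_left, inner_sub_right, hsym, real_inner_smul_left,
      real_inner_smul_right]
  have hSpos (x : E) : 0 ≤ ⟪x, S x⟫_ℝ := by
    rw [hSinner]; linarith [hc x]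
  have hSw : S w = 0 := by rw [hS, hTw, sub_self]
  let U : Submodule ℝ E := (Submodule.span ℝ {w})ᗮ
  have hUdim : Module.finrank ℝ U < d := by
    have h := (Submodule.span ℝ {w}).finrank_add_finrank_orthogonal
    rw [finrank_span_singleton hw, hd] at h
    change 1 + Module.finrank ℝ U = d at h
    omega
  have hSproj (x : E) : S (U.orthogonalProjectionOnto x : E) = S x := by
    have hmem : x - U.orthogonalProjectionOnto x ∈ Submodule.span ℝ {w} := by
      have h := U.sub_starProjection_mem_orthogonal x
      rwa [Submodule.orthogonal_orthogonal] at h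
    obtain ⟨a, ha⟩ := Submodule.mem_span_singleton.1 hmem
    rw [← sub_eq_zero, ← map_sub, ← neg_sub, ← ha, map_neg, map_smul, hSw, smul_zero, neg_zero]
  let R : U →ₗ[ℝ] U := U.orthogonalProjectionOnto.toLinearMap ∘ₗ S ∘ₗ U.subtype
  have hR (x y : U) : ⟪x, R y⟫_ℝ = ⟪(x : E), S y⟫_ℝ :=
    U.inner_orthogonalProjectionOnto_eq_of_mem_left x (S y)
  have hRsym : R.IsSymmetric := fun x y => by
    rw [real_inner_comm, hR, hR, real_inner_comm, hSsym]
  obtain ⟨p₀, hp₀, hp₀S⟩ := ih _ hUdim rfl (hv.orthogonalProjectionOnto U) hRsym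
    fun x => (hR x x).symm ▸ hSpos x
  have hp₀mem : (p₀ : E) ∈ slabs v := fun i => by
    have h := hp₀ i
    rwa [U.inner_orthogonalProjectionOnto_eq_of_mem_left] at h
  have htrace : LinearMap.trace ℝ U R = LinearMap.trace ℝ E S := by
    rw [(hv.orthogonalProjectionOnto U).trace_eq_sum, hv.trace_eq_sum]
    refine Finset.sum_congr rfl fun i _ => ?_
    rw [hR, hSproj, ← hSsym, hSproj, hSsym]
  have htraceT : LinearMap.trace ℝ E T = LinearMap.trace ℝ E S + c * Module.finrank ℝ E := by
    simp [S]
  obtain ⟨p, hp, hpmax, hpd⟩ := exists_mem_slabs_isMaxOn hv hSpos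
  refine ⟨p, hp, ?_⟩
  have h₁ : ⟪(p₀ : E), S p₀⟫_ℝ ≤ ⟪p, S p⟫_ℝ := hpmax hp₀mem
  rw [hR, htrace] at hp₀S
  have h₂ := mul_le_mul_of_nonneg_left hpd hc0
  linarith [hSinner p]


theorem ball_prodromou (d n : ℕ) (v : Fin n → EuclideanSpace ℝ (Fin d))
    (hframe : ∀ x : EuclideanSpace ℝ (Fin d),
      ∑ i, (@inner ℝ _ _ (v i) x) • v i = x)
    (T : EuclideanSpace ℝ (Fin d) →ₗ[ℝ] EuclideanSpace ℝ (Fin d))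
    (hTsym : LinearMap.IsSymmetric T)
    (hTpos : ∀ x, (0 : ℝ) ≤ @inner ℝ _ _ x (T x)) :
    ∃ p : EuclideanSpace ℝ (Fin d),
      (∀ i, |@inner ℝ _ _ p (v i)| ≤ 1) ∧
      LinearMap.trace ℝ (EuclideanSpace ℝ (Fin d)) T ≤ @inner ℝ _ _ p (T p) := by
  exact exists_mem_slabs_trace_le d (by simp) hframe hTsym hTpos
end

section
/- If u_1, …, u_n are unit vectors in ℝ^d with n ≤ 2d, then conv{±u_1, …, ±u_n} does not contain the ball of radius strictly greater than √2/√d centered at the origin. -/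
open scoped RealInnerProductSpace

/-- Moving from `v` in a nonzero direction `w` inside the cube `[-1, 1]^ι`, one reaches a point where
a new coordinate attains absolute value `1`. -/
lemma exists_nonneg_hit_cube_face {ι : Type*} [Fintype ι] (v w : ι → ℝ)
    (hv : ∀ i, |v i| ≤ 1) (hw : ∃ i, w i ≠ 0) :
    ∃ t : ℝ, 0 ≤ t ∧ (∀ i, |v i + t * w i| ≤ 1) ∧ ∃ i, w i ≠ 0 ∧ |v i + t * w i| = 1 := by
  classical
  obtain ⟨i₀, hi₀⟩ := hw
  obtain ⟨i, hi, hmin⟩ := Finset.exists_min_image (Finset.univ.filter fun i => w i ≠ 0)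
    (fun i => (|w i| - v i * w i) / w i ^ 2) ⟨i₀, by simpa using hi₀⟩
  have hi : w i ≠ 0 := by simpa using hi
  have hle : ∀ j, v j * w j ≤ |w j| := fun j => by
    calc v j * w j ≤ |v j * w j| := le_abs_self _
      _ = |v j| * |w j| := abs_mul _ _
      _ ≤ |w j| := mul_le_of_le_one_left (abs_nonneg _) (hv j)
  have ht : 0 ≤ (|w i| - v i * w i) / w i ^ 2 :=
    div_nonneg (by linarith [hle i]) (sq_nonneg _)
  refine ⟨_, ht, fun j => ?_, i, hi, ?_⟩
  · by_cases hj : w j = 0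
    · simpa [hj] using hv j
    · have hm := hmin j (by simpa using hj)
      set t := (|w i| - v i * w i) / w i ^ 2
      rw [le_div_iff₀ (by positivity)] at hm
      obtain ⟨h1, h2⟩ := abs_le.1 (hv j)
      rw [abs_le]
      rcases lt_or_gt_of_ne hj with h | h
      · rw [abs_of_neg h] at hm
        constructor
        · nlinarith
        · nlinarith
      · rw [abs_of_pos h] at hm
        constructor
        · nlinarith
        · nlinarith
  · rcases lt_or_gt_of_ne hi with h | h
    · have : v i + (|w i| - v i * w i) / w i ^ 2 * w i = -1 := by
        rw [abs_of_neg h]; field_simp; ring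
      rw [this]; simp
    · have : v i + (|w i| - v i * w i) / w i ^ 2 * w i = 1 := by
        rw [abs_of_pos h]; field_simp; ring
      rw [this]; simp

section SlabPolytope

variable {ι E : Type*} [Fintype ι] [NormedAddCommGroup E] [InnerProductSpace ℝ E]
  [FiniteDimensional ℝ E]

/-- If fewer than `dim W` of the slab constraints are tight at `x`, then one can move along `W` to a
point of the polytope with more tight constraints, without decreasing `‖x‖² - c ∑ ⟪u i, x⟫²`. -/
lemma exists_card_tight_lt (u : ι → E) (hinj : ∀ z, (∀ i, ⟪u i, z⟫ = 0) → z = 0)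
    (W : Submodule ℝ E) (c : ℝ) (hW : ∀ z ∈ W, c * ∑ i, ⟪u i, z⟫ ^ 2 ≤ ‖z‖ ^ 2)
    (x : E) (hx : ∀ i, |⟪u i, x⟫| ≤ 1)
    (hcard : (Finset.univ.filter fun i => |⟪u i, x⟫| = 1).card < Module.finrank ℝ W) :
    ∃ y, (∀ i, |⟪u i, y⟫| ≤ 1) ∧
      ‖x‖ ^ 2 - c * ∑ i, ⟪u i, x⟫ ^ 2 ≤ ‖y‖ ^ 2 - c * ∑ i, ⟪u i, y⟫ ^ 2 ∧
      (Finset.univ.filter fun i => |⟪u i, x⟫| = 1).card <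
        (Finset.univ.filter fun i => |⟪u i, y⟫| = 1).card := by
  classical
  set J := Finset.univ.filter fun i => |⟪u i, x⟫| = 1
  obtain ⟨z, hzW, hz0, hzJ⟩ : ∃ z ∈ W, z ≠ 0 ∧ ∀ i ∈ J, ⟪u i, z⟫ = 0 := by
    let f : W →ₗ[ℝ] (J → ℝ) := LinearMap.pi fun i => (innerₛₗ ℝ (u i)).comp W.subtype
    have hker : LinearMap.ker f ≠ ⊥ := LinearMap.ker_ne_bot_of_finrank_lt (by simpa using hcard)
    obtain ⟨z, hz, hz0⟩ := Submodule.exists_mem_ne_zero_of_ne_bot hker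
    refine ⟨z, z.2, by simpa using hz0, fun i hi => ?_⟩
    simpa [f] using congrFun (LinearMap.mem_ker.1 hz) ⟨i, hi⟩
  wlog hsign : 0 ≤ ⟪x, z⟫ - c * ∑ i, ⟪u i, x⟫ * ⟪u i, z⟫ generalizing z
  · refine this (-z) (neg_mem hzW) (neg_ne_zero.2 hz0) (fun i hi => by simp [hzJ i hi]) ?_
    simp only [inner_neg_right, mul_neg, Finset.sum_neg_distrib]
    linarith
  have hne : ∃ i, ⟪u i, z⟫ ≠ 0 := by
    by_contra! h
    exact hz0 (hinj z h)
  obtain ⟨t, ht, hfeas, k, hk, hk1⟩ :=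
    exists_nonneg_hit_cube_face (fun i => ⟪u i, x⟫) (fun i => ⟪u i, z⟫) hx hne
  have hinner : ∀ i, ⟪u i, x + t • z⟫ = ⟪u i, x⟫ + t * ⟪u i, z⟫ := fun i => by
    rw [inner_add_right, inner_smul_right]
  refine ⟨x + t • z, fun i => by rw [hinner]; exact hfeas i, ?_, ?_⟩
  · have hnorm : ‖x + t • z‖ ^ 2 = ‖x‖ ^ 2 + 2 * t * ⟪x, z⟫ + t ^ 2 * ‖z‖ ^ 2 := by
      rw [norm_add_sq_real, inner_smul_right, norm_smul, mul_pow, Real.norm_eq_abs, sq_abs]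
      ring
    have hsum : ∑ i, ⟪u i, x + t • z⟫ ^ 2 = ∑ i, ⟪u i, x⟫ ^ 2 +
        2 * t * ∑ i, ⟪u i, x⟫ * ⟪u i, z⟫ + t ^ 2 * ∑ i, ⟪u i, z⟫ ^ 2 := by
      rw [Finset.mul_sum, Finset.mul_sum, ← Finset.sum_add_distrib, ← Finset.sum_add_distrib]
      exact Finset.sum_congr rfl fun i _ => by rw [hinner]; ring
    rw [hnorm, hsum]
    linarith [mul_nonneg ht hsign, mul_nonneg (sq_nonneg t) (sub_nonneg.2 (hW z hzW))]
  · refine Finset.card_lt_card (Finset.ssubset_iff_of_subset ?_ |>.2 ⟨k, ?_, ?_⟩)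
    · intro i hi
      have : |⟪u i, x⟫| = 1 := by simpa [J] using hi
      simp [hinner, hzJ i hi, this]
    · simpa [hinner] using hk1
    · exact fun h => hk (hzJ k h)

lemma exists_finrank_le_sum_sq_inner (u : ι → E) (hinj : ∀ z, (∀ i, ⟪u i, z⟫ = 0) → z = 0)
    (W : Submodule ℝ E) (c : ℝ) (hW : ∀ z ∈ W, c * ∑ i, ⟪u i, z⟫ ^ 2 ≤ ‖z‖ ^ 2)
    (x : E) (hx : ∀ i, |⟪u i, x⟫| ≤ 1) :
    ∃ y, (∀ i, |⟪u i, y⟫| ≤ 1) ∧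
      ‖x‖ ^ 2 - c * ∑ i, ⟪u i, x⟫ ^ 2 ≤ ‖y‖ ^ 2 - c * ∑ i, ⟪u i, y⟫ ^ 2 ∧
      (Module.finrank ℝ W : ℝ) ≤ ∑ i, ⟪u i, y⟫ ^ 2 := by
  classical
  induction hm : Fintype.card ι - (Finset.univ.filter fun i => |⟪u i, x⟫| = 1).card
    using Nat.strong_induction_on generalizing x with
  | _ m ih =>
    by_cases hcard : (Finset.univ.filter fun i => |⟪u i, x⟫| = 1).card < Module.finrank ℝ W
    · obtain ⟨y, hy, hxy, hlt⟩ := exists_card_tight_lt u hinj W c hW x hx hcard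
      have hle := Finset.card_le_univ (Finset.univ.filter fun i => |⟪u i, y⟫| = 1)
      obtain ⟨y', hy', hyy', hfin⟩ := ih _ (by omega) y hy rfl
      exact ⟨y', hy', hxy.trans hyy', hfin⟩
    · refine ⟨x, hx, le_rfl, ?_⟩
      calc (Module.finrank ℝ W : ℝ)
          ≤ ((Finset.univ.filter fun i => |⟪u i, x⟫| = 1).card : ℝ) := by
            exact_mod_cast not_lt.1 hcard
        _ = ∑ i ∈ Finset.univ.filter fun i => |⟪u i, x⟫| = 1, ⟪u i, x⟫ ^ 2 := by
            rw [Finset.card_eq_sum_ones, Nat.cast_sum]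
            refine Finset.sum_congr rfl fun i hi => ?_
            have : |⟪u i, x⟫| = 1 := by simpa using hi
            rw [← sq_abs, this]; norm_num
        _ ≤ ∑ i, ⟪u i, x⟫ ^ 2 :=
            Finset.sum_le_sum_of_subset_of_nonneg (Finset.subset_univ _)
              fun _ _ _ => sq_nonneg _

lemma exists_sum_range_le_norm_sq (u : ι → E) (hinj : ∀ z, (∀ i, ⟪u i, z⟫ = 0) → z = 0)
    (W : ℕ → Submodule ℝ E) (c : ℕ → ℝ) (hc : Antitone c) (hc0 : ∀ k, 0 ≤ c k) (m : ℕ)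
    (hW : ∀ k < m, ∀ z ∈ W k, c k * ∑ i, ⟪u i, z⟫ ^ 2 ≤ ‖z‖ ^ 2)
    (hrank : ∀ k < m, Module.finrank ℝ (W k) = k + 1) :
    ∃ x, (∀ i, |⟪u i, x⟫| ≤ 1) ∧ ∑ k ∈ Finset.range m, c k ≤ ‖x‖ ^ 2 := by
  suffices h : ∀ k ≤ m, ∃ x, (∀ i, |⟪u i, x⟫| ≤ 1) ∧ (k : ℝ) ≤ ∑ i, ⟪u i, x⟫ ^ 2 ∧
      ∀ a, (∀ j < k, a ≤ c j) →
        ∑ j ∈ Finset.range k, c j - k * a ≤ ‖x‖ ^ 2 - a * ∑ i, ⟪u i, x⟫ ^ 2 by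
    obtain ⟨x, hx, -, h⟩ := h m le_rfl
    exact ⟨x, hx, by simpa using h 0 fun j _ => hc0 j⟩
  intro k
  induction k with
  | zero => exact fun _ => ⟨0, by simp, by simp, by simp⟩
  | succ k ih =>
    intro hk
    obtain ⟨x, hx, -, hxa⟩ := ih (by omega)
    obtain ⟨y, hy, hxy, hfin⟩ :=
      exists_finrank_le_sum_sq_inner u hinj (W k) (c k) (hW k hk) x hx
    rw [hrank k hk] at hfin
    refine ⟨y, hy, hfin, fun a ha => ?_⟩
    have h1 := hxa (c k) fun j hj => hc hj.le
    have h2 := mul_le_mul_of_nonneg_left hfin (sub_nonneg.2 (ha k (Nat.lt_succ_self k)))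
    rw [Finset.sum_range_succ]
    push_cast at h2 ⊢
    linarith

/-- The frame operator of a finite family of vectors is diagonal in an orthonormal basis, with
eigenvalues in increasing order. -/
lemma exists_orthonormalBasis_frame (u : ι → E) (d : ℕ) (hd : Module.finrank ℝ E = d) :
    ∃ (b : OrthonormalBasis (Fin d) ℝ E) (s : Fin d → ℝ), Monotone s ∧
      ∀ z, ∑ i, ⟪u i, z⟫ ^ 2 = ∑ j, s j * ⟪b j, z⟫ ^ 2 := by
  let T : E →ₗ[ℝ] E := ∑ i, (innerₛₗ ℝ (u i)).smulRight (u i)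
  have hTapp : ∀ z, T z = ∑ i, ⟪u i, z⟫ • u i := fun z => by simp [T]
  have hT : T.IsSymmetric := fun x y => by
    rw [hTapp, hTapp, sum_inner, inner_sum]
    refine Finset.sum_congr rfl fun i _ => ?_
    rw [real_inner_smul_left, real_inner_smul_right, real_inner_comm x (u i)]
    ring
  refine ⟨(hT.eigenvectorBasis hd).reindex Fin.revPerm, fun j => hT.eigenvalues hd j.rev,
    fun i j hij => hT.eigenvalues_antitone hd (Fin.rev_le_rev.2 hij), fun z => ?_⟩
  have h1 : ∑ i, ⟪u i, z⟫ ^ 2 = ⟪T z, z⟫ := by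
    rw [hTapp, sum_inner]
    exact Finset.sum_congr rfl fun i _ => by rw [real_inner_smul_left, sq]
  have h2 : ∀ j, ⟪T z, hT.eigenvectorBasis hd j⟫ =
      hT.eigenvalues hd j * ⟪hT.eigenvectorBasis hd j, z⟫ := fun j => by
    rw [hT, hT.apply_eigenvectorBasis hd j, inner_smul_right, real_inner_comm]
    rfl
  rw [h1, ← (hT.eigenvectorBasis hd).sum_inner_mul_inner, ← Equiv.sum_comp Fin.revPerm]
  refine Finset.sum_congr rfl fun j _ => ?_
  rw [h2]
  simp [sq, mul_assoc]

/-- The polytope `{x | ∀ i, |⟪u i, x⟫| ≤ 1}` contains a point of norm at least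
`d / √(∑ ‖u i‖²)`. -/
lemma exists_sq_finrank_le_mul_norm_sq (u : ι → E) (hinj : ∀ z, (∀ i, ⟪u i, z⟫ = 0) → z = 0) :
    ∃ x, (∀ i, |⟪u i, x⟫| ≤ 1) ∧
      (Module.finrank ℝ E : ℝ) ^ 2 ≤ (∑ i, ‖u i‖ ^ 2) * ‖x‖ ^ 2 := by
  obtain ⟨d, hd⟩ : ∃ d, Module.finrank ℝ E = d := ⟨_, rfl⟩
  obtain ⟨b, s, hs, hbs⟩ := exists_orthonormalBasis_frame u d hd
  have hsj : ∀ j, s j = ∑ i, ⟪u i, b j⟫ ^ 2 := fun j => by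
    rw [hbs, Finset.sum_eq_single j]
    · simp
    · intro k _ hk
      rw [b.inner_eq_zero hk]; simp
    · simp
  have hpos : ∀ j, 0 < s j := fun j => by
    rw [hsj]
    refine lt_of_le_of_ne (Finset.sum_nonneg fun _ _ => sq_nonneg _) fun h => ?_
    have h0 := (Finset.sum_eq_zero_iff_of_nonneg fun _ _ => sq_nonneg _).1 h.symm
    refine b.toBasis.ne_zero j ?_
    rw [b.coe_toBasis]
    exact hinj _ fun i => by simpa using h0 i (Finset.mem_univ i)
  have htrace : ∑ j, s j = ∑ i, ‖u i‖ ^ 2 := by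
    simp_rw [hsj]
    rw [Finset.sum_comm]
    exact Finset.sum_congr rfl fun i _ => b.sum_sq_inner_left (u i)
  let c : ℕ → ℝ := fun k => if h : k < d then (s ⟨k, h⟩)⁻¹ else 0
  have hc0 : ∀ k, 0 ≤ c k := fun k => by
    by_cases h : k < d
    · simpa [c, h] using (hpos _).le
    · simp [c, h]
  have hc : Antitone c := fun k l hkl => by
    by_cases h : l < d
    · have hk : k < d := hkl.trans_lt h
      simp only [c, h, hk, dif_pos]
      exact inv_anti₀ (hpos _) (hs hkl)
    · simpa [c, h] using hc0 k
  let W : ℕ → Submodule ℝ E := fun k =>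
    Submodule.span ℝ (Set.range fun j : {j : Fin d // j.1 < k + 1} => b j)
  have hWb : ∀ k, ∀ z ∈ W k, ∀ j : Fin d, k < j.1 → ⟪b j, z⟫ = 0 := by
    intro k z hz j hj
    induction hz using Submodule.span_induction with
    | mem y hy =>
      obtain ⟨l, rfl⟩ := hy
      exact b.inner_eq_zero fun h => by have := l.2; rw [← h] at this; omega
    | zero => simp
    | add y y' _ _ hy hy' => rw [inner_add_right, hy, hy', add_zero]
    | smul a y _ hy => rw [inner_smul_right, hy, mul_zero]
  obtain ⟨x, hx, hxc⟩ := exists_sum_range_le_norm_sq u hinj W c hc hc0 d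
    (fun k hk z hz => by
      rw [hbs, ← b.sum_sq_inner_right z, Finset.mul_sum]
      refine Finset.sum_le_sum fun j _ => ?_
      rcases lt_or_ge k j.1 with hj | hj
      · simp [hWb k z hz j hj]
      · have hle : c k * s j ≤ 1 := by
          simp only [c, hk, dif_pos]
          rw [inv_mul_le_one₀ (hpos _)]
          exact hs hj
        rw [← mul_assoc]
        exact mul_le_of_le_one_left (sq_nonneg _) hle)
    (fun k hk => by
      have hli : LinearIndependent ℝ fun j : {j : Fin d // j.1 < k + 1} => b j :=
        b.orthonormal.linearIndependent.comp _ Subtype.val_injective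
      rw [finrank_span_eq_card hli, Fintype.card_subtype, Fin.card_filter_val_lt]
      omega)
  refine ⟨x, hx, ?_⟩
  have hsum : ∑ k ∈ Finset.range d, c k = ∑ j, (s j)⁻¹ := by
    rw [Finset.sum_range]
    exact Finset.sum_congr rfl fun j _ => by simp [c]
  rw [hsum] at hxc
  rw [hd, ← htrace]
  calc (d : ℝ) ^ 2 = (∑ _j : Fin d, (1 : ℝ)) ^ 2 := by simp
    _ ≤ (∑ j, s j) * ∑ j, (s j)⁻¹ :=
      Finset.sum_sq_le_sum_mul_sum_of_sq_le_mul _ (fun j _ => (hpos j).le)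
        (fun j _ => (inv_pos.2 (hpos j)).le)
        fun j _ => by rw [one_pow, mul_inv_cancel₀ (hpos j).ne']
    _ ≤ (∑ j, s j) * ‖x‖ ^ 2 :=
      mul_le_mul_of_nonneg_left hxc (Finset.sum_nonneg fun j _ => (hpos j).le)

end SlabPolytope

theorem qst_upper_bound_2d (d n : ℕ) (hn : n ≤ 2 * d)
    (u : Fin n → EuclideanSpace ℝ (Fin d))
    (hu : ∀ i, ‖u i‖ = 1) :
    ∀ r : ℝ, Real.sqrt 2 / Real.sqrt d < r →
      ¬ Metric.closedBall (0 : EuclideanSpace ℝ (Fin d)) r ⊆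
          convexHull ℝ (Set.range u ∪ Set.range (fun i => -u i)) := by
  intro r hr hsub
  have hr0 : 0 < r := lt_of_le_of_lt (by positivity) hr
  have hbound : ∀ x, (∀ i, |⟪u i, x⟫| ≤ 1) → r * ‖x‖ ≤ 1 := by
    intro x hx
    by_cases hx0 : x = 0
    · simp [hx0]
    have hx0' : ‖x‖ ≠ 0 := norm_ne_zero_iff.2 hx0
    have hhull : convexHull ℝ (Set.range u ∪ Set.range (fun i => -u i)) ⊆
        {y | innerₛₗ ℝ x y ≤ 1} := by
      refine convexHull_min ?_ (convex_halfSpace_le (innerₛₗ ℝ x).isLinear 1)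
      rintro _ (⟨i, rfl⟩ | ⟨i, rfl⟩)
      · have := (abs_le.1 (hx i)).2
        simpa [real_inner_comm] using this
      · have := (abs_le.1 (hx i)).1
        simp only [Set.mem_ofPred_eq, innerₛₗ_apply_apply, inner_neg_right]
        rw [real_inner_comm]
        linarith
    have hmem : (r / ‖x‖) • x ∈ Metric.closedBall (0 : EuclideanSpace ℝ (Fin d)) r := by
      rw [mem_closedBall_zero_iff, norm_smul, Real.norm_of_nonneg (by positivity)]
      exact (div_mul_cancel₀ r hx0').le
    have h := hhull (hsub hmem)
    simp only [Set.mem_ofPred_eq, innerₛₗ_apply_apply, inner_smul_right,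
      real_inner_self_eq_norm_sq] at h
    calc r * ‖x‖ = r / ‖x‖ * ‖x‖ ^ 2 := by field_simp
      _ ≤ 1 := h
  have hinj : ∀ z, (∀ i, ⟪u i, z⟫ = 0) → z = 0 := by
    intro z hz
    by_contra hz0
    have hz0' : 0 < ‖z‖ := norm_pos_iff.2 hz0
    have h := hbound ((2 / (r * ‖z‖)) • z) fun i => by simp [inner_smul_right, hz i]
    rw [norm_smul, Real.norm_of_nonneg (by positivity)] at h
    have : r * (2 / (r * ‖z‖) * ‖z‖) = 2 := by field_simp
    linarith
  have hd : 0 < d := by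
    rcases Nat.eq_zero_or_pos d with rfl | hd
    · obtain rfl : n = 0 := by omega
      have := hsub (Metric.mem_closedBall_self hr0.le)
      simp at this
    · exact hd
  have hd' : (0 : ℝ) < d := Nat.cast_pos.2 hd
  obtain ⟨x, hx, hxd⟩ := exists_sq_finrank_le_mul_norm_sq u hinj
  have hsq : 2 < r ^ 2 * d := by
    rw [← Real.sqrt_div zero_le_two, Real.sqrt_lt' hr0, div_lt_iff₀ hd'] at hr
    exact hr
  have hrx : r ^ 2 * ‖x‖ ^ 2 ≤ 1 := by
    rw [← mul_pow]
    exact pow_le_one₀ (by positivity) (hbound x hx)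
  have hn' : (n : ℝ) ≤ 2 * d := by exact_mod_cast hn
  simp only [hu, one_pow, Finset.sum_const, Finset.card_univ, Fintype.card_fin, nsmul_eq_mul,
    mul_one, finrank_euclideanSpace] at hxd
  have h1 : r ^ 2 * (d : ℝ) ^ 2 ≤ n := by
    calc r ^ 2 * (d : ℝ) ^ 2 ≤ r ^ 2 * (n * ‖x‖ ^ 2) := by gcongr
      _ = n * (r ^ 2 * ‖x‖ ^ 2) := by ring
      _ ≤ n := mul_le_of_le_one_right (Nat.cast_nonneg n) hrx
  nlinarith
end
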